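/- There exists an absolute constant C > 0 such that for every reduced rational α = v/w ∈ (0,1] and every real U ≥ 2, the count R_{2,α}(U) of quadruples (p,q,n,k) ∈ ℕ⁴ satisfying gcd(p,q) = 1, 2 ≤ p ≤ q, U < q, 2 ≤ nq + kp ≤ U², 1 ≤ k < n, and inv_p(q) ≤ α·p, obeys | R_{2,α}(U) − (α log 2 /(2ζ(2)))·U⁴ log U | ≤ C·U⁴. -/

import Mathlib

/-- `inv_p(q)`: the least positive integer in the residue class `q⁻¹ (mod p)`. -/
def modInv (p q : ℕ) : ℕ := if ((q : ZMod p)⁻¹).val = 0 then p else ((q : ZMod p)⁻¹).val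

/-- The system of Case 2: `gcd(p,q) = 1`, `2 ≤ p ≤ q`, `U < q`, `2 ≤ nq + kp ≤ U²`,
`1 ≤ k < n`, `inv_p(q) ≤ α·p`. -/
def Case2 (α : ℚ) (U : ℝ) (p q n k : ℕ) : Prop :=
  Nat.gcd p q = 1 ∧ 2 ≤ p ∧ p ≤ q ∧ U < (q : ℝ) ∧
  2 ≤ n * q + k * p ∧ ((n * q + k * p : ℕ) : ℝ) ≤ U ^ 2 ∧
  1 ≤ k ∧ k < n ∧ (modInv p q : ℝ) ≤ (α : ℝ) * p

open Finset

def GG {N : ℕ} (m : ZMod N) : ℕ := Nat.gcd m.val N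

lemma GG_pos {N : ℕ} [NeZero N] (m : ZMod N) : 0 < GG m :=
  Nat.gcd_pos_of_pos_right _ (NeZero.pos N)

lemma zcard_mul_eq {N : ℕ} [NeZero N] (m c : ZMod N) :
    (univ.filter (fun v : ZMod N => v * m = c)).card ≤ GG m := by
  classical
  have key : ∀ v : ZMod N, v * m = 0 → GG m • v = 0 := by
    intro v hv
    have h := Nat.gcd_eq_gcd_ab m.val N
    have h2 : ((GG m : ℕ) : ZMod N) = m * (Nat.gcdA m.val N : ZMod N) := by
      have := congrArg (fun z : ℤ => (z : ZMod N)) h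
      simpa [GG] using this
    rw [nsmul_eq_mul, h2, mul_right_comm, mul_comm m v, hv, zero_mul]
  rcases (univ.filter (fun v : ZMod N => v * m = c)).eq_empty_or_nonempty with h | ⟨v0, hv0⟩
  · rw [h]; simp
  · have hv0' : v0 * m = c := by simpa using hv0
    refine le_trans ?_ (IsAddCyclic.card_nsmul_eq_zero_le (α := ZMod N) (GG_pos m))
    refine card_le_card_of_injOn (fun v => v - v0) ?_ (fun a _ b _ h => by simpa using h)
    intro v hv
    have hv' : v * m = c := by simpa using hv
    have : (v - v0) * m = 0 := by rw [sub_mul, hv', hv0', sub_self]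
    simpa using key _ this

lemma GG_natCast {N : ℕ} [NeZero N] (k : ℕ) : GG (k : ZMod N) = Nat.gcd k N := by
  unfold GG
  rw [ZMod.val_natCast, ← Nat.gcd_rec, Nat.gcd_comm]

lemma GG_mul {N : ℕ} [NeZero N] (a b : ZMod N) : GG (a * b) ≤ GG a * GG b := by
  have : a * b = ((a.val * b.val : ℕ) : ZMod N) := by simp
  rw [this, GG_natCast]
  refine Nat.le_of_dvd (Nat.mul_pos (GG_pos a) (GG_pos b)) ?_
  unfold GG
  exact Nat.gcd_mul_left_dvd_mul_gcd _ _ _ 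

lemma GG_two {N : ℕ} [NeZero N] : GG (2 : ZMod N) ≤ 2 := by
  have := GG_natCast (N := N) 2
  push_cast at this
  rw [this]
  exact Nat.gcd_le_left _ (by norm_num)

lemma sum_GG {N : ℕ} [NeZero N] : ∑ v : ZMod N, GG v ≤ N * N.divisors.card := by
  classical
  have hN := NeZero.pos N
  calc ∑ v : ZMod N, GG v ≤ ∑ v : ZMod N, ∑ d ∈ N.divisors, if ((N/d : ℕ) : ZMod N) * v = 0 then d else 0 := by
        refine sum_le_sum fun v _ => ?_
        have hd : GG v ∈ N.divisors := Nat.mem_divisors.2 ⟨Nat.gcd_dvd_right _ _, hN.ne'⟩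
        have hz : ((N / GG v : ℕ) : ZMod N) * v = 0 := by
          have : v = ((v.val : ℕ) : ZMod N) := by simp
          have h5 : ((N / GG v : ℕ) : ZMod N) * v = ((N / GG v : ℕ) : ZMod N) * ((v.val : ℕ) : ZMod N) := by
            simp
          rw [h5, ← Nat.cast_mul, ZMod.natCast_eq_zero_iff]
          obtain ⟨t, ht⟩ : GG v ∣ v.val := Nat.gcd_dvd_left _ _
          have h2 : N / GG v * v.val = (N / GG v * GG v) * t := by
            conv_lhs => rw [ht]
            ring
          rw [h2, Nat.div_mul_cancel (show GG v ∣ N from Nat.gcd_dvd_right _ _)]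
          exact dvd_mul_right _ _
        refine le_trans (by rw [if_pos hz]) (single_le_sum (f := fun d => if ((N/d : ℕ) : ZMod N) * v = 0 then d else 0) (fun _ _ => Nat.zero_le _) hd)
    _ = ∑ d ∈ N.divisors, d * (univ.filter (fun v : ZMod N => v * ((N/d : ℕ) : ZMod N) = 0)).card := by
        rw [sum_comm]
        refine sum_congr rfl fun d _ => ?_
        rw [← sum_filter, sum_const, smul_eq_mul, mul_comm]
        simp only [mul_comm]
    _ ≤ ∑ d ∈ N.divisors, N := by
        refine sum_le_sum fun d hd => ?_
        have hd' := Nat.dvd_of_mem_divisors hd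
        have := zcard_mul_eq ((N/d : ℕ) : ZMod N) 0
        rw [GG_natCast] at this
        have h3 : Nat.gcd (N/d) N = N / d := Nat.gcd_eq_left (Nat.div_dvd_of_dvd hd')
        rw [h3] at this
        calc _ ≤ d * (N/d) := Nat.mul_le_mul_left _ this
          _ = N := Nat.mul_div_cancel' hd'
    _ = N * N.divisors.card := by simp [mul_comm]

lemma parseval2 {N : ℕ} [NeZero N] {ι : Type*} [Fintype ι] (f g : ι → ZMod N) :
    ∑ m : ZMod N, ∑ n : ZMod N, ‖∑ i, ZMod.stdAddChar (m * f i + n * g i)‖ ^ 2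
      = (N:ℝ)^2 * (univ.filter (fun p : ι × ι => f p.1 = f p.2 ∧ g p.1 = g p.2)).card := by
  classical
  have hsum : ∀ b : ZMod N, ∑ m : ZMod N, ZMod.stdAddChar (m * b) = if b = 0 then (N:ℂ) else 0 := by
    intro b
    have := AddChar.sum_mulShift b (ZMod.isPrimitive_stdAddChar N)
    simpa using this
  have h1 : ∀ m n : ZMod N, ((‖∑ i, ZMod.stdAddChar (m * f i + n * g i)‖ ^ 2 : ℝ) : ℂ)
      = ∑ p : ι × ι, ZMod.stdAddChar (m * (f p.1 - f p.2)) * ZMod.stdAddChar (n * (g p.1 - g p.2)) := by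
    intro m n
    push_cast
    rw [← Complex.mul_conj', map_sum, sum_mul_sum, ← sum_product']
    refine sum_congr rfl fun p _ => ?_
    rw [← AddChar.map_neg_eq_conj, ← AddChar.map_add_eq_mul, ← AddChar.map_add_eq_mul]
    congr 1
    ring
  have : ((∑ m : ZMod N, ∑ n : ZMod N, ‖∑ i, ZMod.stdAddChar (m * f i + n * g i)‖ ^ 2 : ℝ) : ℂ)
      = (((N:ℝ)^2 * (univ.filter (fun p : ι × ι => f p.1 = f p.2 ∧ g p.1 = g p.2)).card : ℝ) : ℂ) := by
    rw [Complex.ofReal_sum]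
    simp_rw [Complex.ofReal_sum, h1]
    have : ∀ m : ZMod N, ∑ n : ZMod N, ∑ p : ι × ι, ZMod.stdAddChar (m * (f p.1 - f p.2)) * ZMod.stdAddChar (n * (g p.1 - g p.2)) = ∑ p : ι × ι, ZMod.stdAddChar (m * (f p.1 - f p.2)) * (if g p.1 - g p.2 = 0 then (N:ℂ) else 0) := by
      intro m
      rw [sum_comm]
      refine sum_congr rfl fun p _ => ?_
      rw [← mul_sum, hsum]
    simp_rw [this]
    rw [sum_comm]
    simp_rw [← sum_mul, hsum]
    rw [card_filter]
    push_cast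
    rw [mul_sum]
    refine sum_congr rfl fun p _ => ?_
    by_cases h1 : f p.1 = f p.2 <;> by_cases h2 : g p.1 = g p.2 <;> simp [h1, h2, sub_eq_zero, pow_two]
  exact_mod_cast this

noncomputable def KS {N : ℕ} [NeZero N] (m n : ZMod N) : ℂ :=
  ∑ u : (ZMod N)ˣ, ZMod.stdAddChar (m * (u : ZMod N) + n * ((u⁻¹ : (ZMod N)ˣ) : ZMod N))

lemma count4 {N : ℕ} [NeZero N] :
    (univ.filter (fun p : ((ZMod N)ˣ × (ZMod N)ˣ) × ((ZMod N)ˣ × (ZMod N)ˣ) =>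
      ((p.1.1 : ZMod N) + p.1.2 = p.2.1 + p.2.2) ∧
      (((p.1.1⁻¹ : (ZMod N)ˣ) : ZMod N) + ((p.1.2⁻¹ : (ZMod N)ˣ) : ZMod N)
        = ((p.2.1⁻¹ : (ZMod N)ˣ) : ZMod N) + ((p.2.2⁻¹ : (ZMod N)ˣ) : ZMod N)))).card
      ≤ 2 * (N * N.divisors.card)^2 := by
  classical
  calc _ ≤ (univ.filter (fun t : (ZMod N × ZMod N) × ZMod N =>
          t.2 * (2 * (t.1.1 * t.1.2)) = (t.1.1 + t.1.2) * (t.1.1 * t.1.2))).card := by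
        refine card_le_card_of_injOn (fun p => (((p.2.1 : ZMod N) - p.1.1, (p.2.1 : ZMod N) - p.1.2), (p.2.1 : ZMod N))) ?_ ?_
        · rintro ⟨⟨x, y⟩, ⟨z, w⟩⟩ h
          simp only [coe_filter, mem_univ, true_and, Set.mem_ofPred_eq] at h ⊢
          obtain ⟨h1, h2⟩ := h
          have hx : (x : ZMod N) * ((x⁻¹ : (ZMod N)ˣ) : ZMod N) = 1 := by simp
          have hy : (y : ZMod N) * ((y⁻¹ : (ZMod N)ˣ) : ZMod N) = 1 := by simp
          have hz : (z : ZMod N) * ((z⁻¹ : (ZMod N)ˣ) : ZMod N) = 1 := by simp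
          have hw : (w : ZMod N) * ((w⁻¹ : (ZMod N)ˣ) : ZMod N) = 1 := by simp
          generalize ((x⁻¹ : (ZMod N)ˣ) : ZMod N) = a at *
          generalize ((y⁻¹ : (ZMod N)ˣ) : ZMod N) = b at *
          generalize ((z⁻¹ : (ZMod N)ˣ) : ZMod N) = c at *
          generalize ((w⁻¹ : (ZMod N)ˣ) : ZMod N) = d at *
          generalize (x : ZMod N) = x at *
          generalize (y : ZMod N) = y at *
          generalize (z : ZMod N) = z at *
          generalize (w : ZMod N) = w at *
          have hs1 : x + y = x * y * (a + b) := by linear_combination -y * hx - x * hy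
          have hs2 : z + w = z * w * (c + d) := by linear_combination -w * hz - z * hw
          have key : (x + y) * (x * y - z * w) = 0 := by
            linear_combination x * y * h1 + x * y * hs2 - z * w * hs1 - x * y * z * w * h2
          linear_combination key - (x + y) * z * h1
        · rintro ⟨⟨x, y⟩, ⟨z, w⟩⟩ h ⟨⟨x', y'⟩, ⟨z', w'⟩⟩ h' hh
          simp only [coe_filter, mem_univ, true_and, Set.mem_ofPred_eq, Prod.mk.injEq] at h h' hh ⊢
          obtain ⟨⟨e1, e2⟩, e3⟩ := hh
          have e4 : (x : ZMod N) = x' := by rw [e3] at e1; simpa using e1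
          have e5 : (y : ZMod N) = y' := by rw [e3] at e2; simpa using e2
          have e6 : (w : ZMod N) = w' := by
            have := h.1; have h2 := h'.1
            rw [e4, e5, e3, h2] at this
            simpa using this.symm
          exact ⟨⟨Units.ext e4, Units.ext e5⟩, Units.ext e3, Units.ext e6⟩
    _ = ∑ B : ZMod N, ∑ C : ZMod N, (univ.filter (fun z : ZMod N => z * (2 * (B * C)) = (B + C) * (B * C))).card := by
        rw [card_filter, ← univ_product_univ, sum_product, ← univ_product_univ, sum_product]
        simp_rw [card_filter]
    _ ≤ ∑ B : ZMod N, ∑ C : ZMod N, 2 * (GG B * GG C) := by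
        refine sum_le_sum fun B _ => sum_le_sum fun C _ => ?_
        refine (zcard_mul_eq _ _).trans ?_
        refine (GG_mul _ _).trans ?_
        exact Nat.mul_le_mul GG_two (GG_mul _ _)
    _ = 2 * (∑ v : ZMod N, GG v)^2 := by
        rw [pow_two, sum_mul_sum, mul_sum]
        simp_rw [mul_sum]
    _ ≤ _ := by gcongr; exact sum_GG

lemma KS_unit {N : ℕ} [NeZero N] (m n : ZMod N) (v : (ZMod N)ˣ) :
    KS ((v : ZMod N) * m) (((v⁻¹ : (ZMod N)ˣ) : ZMod N) * n) = KS m n := by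
  unfold KS
  refine Fintype.sum_equiv (Equiv.mulLeft v) _ _ fun u => ?_
  congr 1
  simp only [Equiv.coe_mulLeft, mul_inv, Units.val_mul]
  ring

lemma KS_symm {N : ℕ} [NeZero N] (m n : ZMod N) : KS m n = KS n m := by
  unfold KS
  refine Fintype.sum_equiv (Equiv.inv _) _ _ fun u => ?_
  congr 1
  simp only [Equiv.inv_apply, inv_inv]
  ring

lemma KS_fourth_sum {N : ℕ} [NeZero N] :
    ∑ m : ZMod N, ∑ n : ZMod N, ‖KS m n‖ ^ 4 ≤ (N:ℝ)^2 * (2 * (N * N.divisors.card)^2) := by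
  classical
  have h := parseval2 (N := N) (ι := (ZMod N)ˣ × (ZMod N)ˣ) (fun p => (p.1 : ZMod N) + p.2)
    (fun p => ((p.1⁻¹ : (ZMod N)ˣ) : ZMod N) + ((p.2⁻¹ : (ZMod N)ˣ) : ZMod N))
  have h2 : ∀ m n : ZMod N, ‖KS m n‖ ^ 4 = ‖∑ p : (ZMod N)ˣ × (ZMod N)ˣ, ZMod.stdAddChar (m * ((p.1 : ZMod N) + (p.2 : ZMod N)) + n * (((p.1⁻¹ : (ZMod N)ˣ) : ZMod N) + ((p.2⁻¹ : (ZMod N)ˣ) : ZMod N)))‖ ^ 2 := by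
    intro m n
    have : ‖KS m n‖ ^ 4 = ‖KS m n * KS m n‖ ^ 2 := by rw [norm_mul]; ring
    rw [this]
    congr 2
    unfold KS
    rw [sum_mul_sum, ← sum_product', univ_product_univ]
    refine sum_congr rfl fun p _ => ?_
    rw [← AddChar.map_add_eq_mul]
    congr 1
    ring
  simp_rw [h2]
  rw [h]
  gcongr
  exact_mod_cast count4 (N := N)

lemma le_totient_mul {N : ℕ} (hN : 0 < N) : N ≤ N.totient * N.divisors.card := by
  conv_lhs => rw [← Nat.sum_totient N]
  calc _ ≤ ∑ d ∈ N.divisors, N.totient := by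
        refine sum_le_sum fun d hd => ?_
        exact Nat.le_of_dvd (Nat.totient_pos.2 hN) (Nat.totient_dvd_of_dvd (Nat.dvd_of_mem_divisors hd))
    _ = _ := by simp [mul_comm]

lemma KS_bound4 {N : ℕ} [NeZero N] (m n : ZMod N) :
    ‖KS m n‖ ^ 4 ≤ 2 * GG m * (N:ℝ)^3 * (N.divisors.card : ℝ)^3 := by
  classical
  have hN : 0 < N := NeZero.pos N
  have h1 : (N.totient : ℝ) * ‖KS m n‖ ^ 4 = ∑ v : (ZMod N)ˣ, ‖KS ((v : ZMod N) * m) (((v⁻¹ : (ZMod N)ˣ) : ZMod N) * n)‖ ^ 4 := by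
    simp_rw [KS_unit]
    rw [sum_const, card_univ, ZMod.card_units_eq_totient]
    simp
  have h2 : ∑ v : (ZMod N)ˣ, ‖KS ((v : ZMod N) * m) (((v⁻¹ : (ZMod N)ˣ) : ZMod N) * n)‖ ^ 4
      ≤ ∑ v : (ZMod N)ˣ, ∑ n' : ZMod N, ‖KS ((v : ZMod N) * m) n'‖ ^ 4 := by
    refine sum_le_sum fun v _ => ?_
    exact single_le_sum (f := fun n' => ‖KS ((v : ZMod N) * m) n'‖ ^ 4) (fun _ _ => by positivity) (mem_univ _)
  have h3 : ∑ v : (ZMod N)ˣ, ∑ n' : ZMod N, ‖KS ((v : ZMod N) * m) n'‖ ^ 4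
      ≤ GG m * ∑ m' : ZMod N, ∑ n' : ZMod N, ‖KS m' n'‖ ^ 4 := by
    rw [← sum_fiberwise_of_maps_to (s := univ) (t := univ) (g := fun v : (ZMod N)ˣ => (v : ZMod N) * m) (fun _ _ => mem_univ _), mul_sum]
    refine sum_le_sum fun m' _ => ?_
    have : ∀ v ∈ univ.filter (fun v : (ZMod N)ˣ => (v : ZMod N) * m = m'),
        ∑ n' : ZMod N, ‖KS ((v : ZMod N) * m) n'‖ ^ 4 = ∑ n' : ZMod N, ‖KS m' n'‖ ^ 4 := by
      intro v hv
      rw [(mem_filter.1 hv).2]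
    rw [sum_congr rfl this, sum_const, nsmul_eq_mul]
    refine mul_le_mul_of_nonneg_right ?_ (sum_nonneg fun _ _ => by positivity)
    have : (univ.filter (fun v : (ZMod N)ˣ => (v : ZMod N) * m = m')).card ≤ GG m := by
      refine le_trans ?_ (zcard_mul_eq m m')
      refine card_le_card_of_injOn (fun v => (v : ZMod N)) ?_ (fun a _ b _ h => Units.ext h)
      intro v hv
      simpa using hv
    exact_mod_cast this
  have h4 := KS_fourth_sum (N := N)
  have h5 : (N:ℝ) ≤ N.totient * N.divisors.card := by exact_mod_cast le_totient_mul hN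
  have h6 : (N.totient : ℝ) * ‖KS m n‖ ^ 4 ≤ GG m * ((N:ℝ)^2 * (2 * (N * N.divisors.card)^2)) := by
    rw [h1]
    refine h2.trans (h3.trans ?_)
    gcongr
  have hNr : (0:ℝ) < N := by exact_mod_cast hN
  have h7 : (N:ℝ) * ‖KS m n‖ ^ 4 ≤ N * (2 * GG m * (N:ℝ)^3 * (N.divisors.card : ℝ)^3) := by
    calc (N:ℝ) * ‖KS m n‖ ^ 4 ≤ (N.totient * N.divisors.card) * ‖KS m n‖ ^ 4 := by gcongr
      _ = N.divisors.card * (N.totient * ‖KS m n‖ ^ 4) := by ring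
      _ ≤ N.divisors.card * (GG m * ((N:ℝ)^2 * (2 * (N * N.divisors.card)^2))) := by gcongr
      _ = _ := by ring
  exact le_of_mul_le_mul_left h7 hNr

lemma KS_bound {N : ℕ} [NeZero N] (m n : ZMod N) :
    ‖KS m n‖ ≤ GG m * (2 * (N:ℝ)^(3/4:ℝ) * N.divisors.card) := by
  have hN : 0 < N := NeZero.pos N
  have h := KS_bound4 m n
  have hG : (1:ℝ) ≤ GG m := by exact_mod_cast GG_pos m
  have hd : (1:ℝ) ≤ N.divisors.card := by
    exact_mod_cast Finset.card_pos.2 ⟨1, Nat.one_mem_divisors.2 hN.ne'⟩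
  have hp : ((N:ℝ)^(3/4:ℝ))^4 = (N:ℝ)^3 := by
    rw [← Real.rpow_natCast, ← Real.rpow_mul (by positivity)]
    norm_num
  refine le_of_pow_le_pow_left₀ (n := 4) (by norm_num) (by positivity) (h.trans ?_)
  rw [mul_pow, mul_pow, mul_pow, hp]
  have e1 : (GG m : ℝ) ≤ (GG m : ℝ)^4 := le_self_pow₀ hG (by norm_num)
  have e2 : (N.divisors.card : ℝ)^3 ≤ (N.divisors.card : ℝ)^4 := pow_le_pow_right₀ hd (by norm_num)
  calc 2 * (GG m : ℝ) * (N:ℝ)^3 * (N.divisors.card : ℝ)^3 ≤ 16 * (GG m : ℝ)^4 * (N:ℝ)^3 * (N.divisors.card : ℝ)^4 := by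
        gcongr; norm_num
    _ = _ := by ring

noncomputable def FT {N : ℕ} [NeZero N] (f : ZMod N → ℂ) (m : ZMod N) : ℂ :=
  ∑ x, f x * ZMod.stdAddChar (-(m * x))

lemma FT_inv {N : ℕ} [NeZero N] (f : ZMod N → ℂ) (w : ZMod N) :
    ∑ m : ZMod N, FT f m * ZMod.stdAddChar (m * w) = N * f w := by
  classical
  have hsum : ∀ b : ZMod N, ∑ m : ZMod N, ZMod.stdAddChar (m * b) = if b = 0 then (N:ℂ) else 0 := by
    intro b
    have := AddChar.sum_mulShift b (ZMod.isPrimitive_stdAddChar N)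
    simpa using this
  unfold FT
  simp_rw [sum_mul]
  rw [sum_comm]
  have : ∀ x : ZMod N, ∑ m : ZMod N, f x * ZMod.stdAddChar (-(m * x)) * ZMod.stdAddChar (m * w)
      = f x * (if w - x = 0 then (N:ℂ) else 0) := by
    intro x
    rw [← hsum, mul_sum]
    refine sum_congr rfl fun m _ => ?_
    rw [mul_assoc, ← AddChar.map_add_eq_mul]
    congr 2
    ring
  simp_rw [this, sub_eq_zero]
  simp [mul_comm]

lemma bil {N : ℕ} [NeZero N] (f g : ZMod N → ℂ) :
    ∑ m : ZMod N, ∑ n : ZMod N, FT f m * FT g n * KS m n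
      = (N:ℂ)^2 * ∑ u : (ZMod N)ˣ, f u * g ((u⁻¹ : (ZMod N)ˣ) : ZMod N) := by
  have h : ∀ u : (ZMod N)ˣ, (N:ℂ)^2 * (f u * g ((u⁻¹ : (ZMod N)ˣ) : ZMod N))
      = ∑ m : ZMod N, ∑ n : ZMod N, FT f m * FT g n * ZMod.stdAddChar (m * (u : ZMod N) + n * ((u⁻¹ : (ZMod N)ˣ) : ZMod N)) := by
    intro u
    have : (N:ℂ)^2 * (f u * g ((u⁻¹ : (ZMod N)ˣ) : ZMod N)) = (N * f u) * (N * g ((u⁻¹ : (ZMod N)ˣ) : ZMod N)) := by ring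
    rw [this, ← FT_inv, ← FT_inv, sum_mul_sum]
    refine sum_congr rfl fun m _ => sum_congr rfl fun n _ => ?_
    rw [AddChar.map_add_eq_mul]
    ring
  rw [mul_sum]
  simp_rw [h]
  symm
  rw [sum_comm]
  refine sum_congr rfl fun m _ => ?_
  rw [sum_comm]
  refine sum_congr rfl fun n _ => ?_
  unfold KS
  rw [mul_sum]

noncomputable def bb {N : ℕ} (m : ZMod N) : ℝ := (N:ℝ)/2 * (1/(m.val:ℝ) + 1/((N:ℝ) - m.val))

lemma stdAddChar_sub_one_lower {N : ℕ} [NeZero N] (m : ZMod N) :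
    4 * ((m.val:ℝ)/N) * (1 - (m.val:ℝ)/N) ≤ ‖ZMod.stdAddChar m - 1‖ := by
  have hN : (0:ℝ) < N := by exact_mod_cast NeZero.pos N
  set t : ℝ := (m.val:ℝ)/N with ht
  have ht0 : 0 ≤ t := by positivity
  have ht1 : t ≤ 1 := by
    rw [ht, div_le_one hN]; exact_mod_cast (ZMod.val_lt m).le
  have h1 : ZMod.stdAddChar m = Complex.exp (Complex.I * ((2 * Real.pi * t : ℝ) : ℂ)) := by
    have := ZMod.stdAddChar_coe (N := N) (m.val : ℤ)
    rw [Int.cast_natCast, ZMod.natCast_zmod_val] at this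
    rw [this, ht]
    congr 1
    push_cast
    ring
  rw [h1, Complex.norm_exp_I_mul_ofReal_sub_one]
  have e : 2 * Real.pi * t / 2 = Real.pi * t := by ring
  rw [e, norm_mul, Real.norm_eq_abs, Real.norm_eq_abs, abs_two]
  have hpi := Real.pi_pos
  have key : 2 * t * (1 - t) ≤ Real.sin (Real.pi * t) := by
    rcases le_total t (1/2) with h | h
    · have := Real.mul_le_sin (x := Real.pi * t) (by positivity) (by nlinarith)
      have e2 : 2 / Real.pi * (Real.pi * t) = 2 * t := by field_simp
      nlinarith
    · have := Real.mul_le_sin (x := Real.pi * (1 - t)) (by nlinarith) (by nlinarith)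
      have e2 : 2 / Real.pi * (Real.pi * (1 - t)) = 2 * (1 - t) := by field_simp
      have e3 : Real.sin (Real.pi * (1 - t)) = Real.sin (Real.pi * t) := by
        rw [mul_sub, mul_one, Real.sin_pi_sub]
      nlinarith
  have := le_abs_self (Real.sin (Real.pi * t))
  nlinarith

lemma geom_bound {N : ℕ} [NeZero N] (m : ZMod N) (hm : m ≠ 0) (a L : ℕ) :
    ‖∑ i ∈ range L, ZMod.stdAddChar (-(m * ((a + i : ℕ) : ZMod N)))‖ ≤ bb m := by
  have hN : (0:ℝ) < N := by exact_mod_cast NeZero.pos N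
  have hk : 0 < m.val := Nat.pos_of_ne_zero (by simpa [ZMod.val_eq_zero] using hm)
  have hk' : (0:ℝ) < m.val := by exact_mod_cast hk
  have hkN : (m.val:ℝ) < N := by exact_mod_cast ZMod.val_lt m
  have hz : ∀ i, ZMod.stdAddChar (-(m * ((a + i : ℕ) : ZMod N)))
      = ZMod.stdAddChar (-(m * (a:ZMod N))) * (ZMod.stdAddChar (-m))^i := by
    intro i
    rw [← AddChar.map_nsmul_eq_pow, ← AddChar.map_add_eq_mul]
    congr 1
    push_cast
    rw [nsmul_eq_mul]
    ring
  have hn : ∀ x : ZMod N, ‖ZMod.stdAddChar x‖ = 1 := fun x => by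
    rw [ZMod.stdAddChar_apply]; exact Circle.norm_coe _
  simp_rw [hz]
  rw [← mul_sum, norm_mul, hn, one_mul]
  set z : ℂ := ZMod.stdAddChar (-m) with hzdef
  have hzn : ‖z‖ = 1 := hn _
  have hlow := stdAddChar_sub_one_lower m
  have hlow2 : ‖z - 1‖ = ‖ZMod.stdAddChar m - 1‖ := by
    rw [hzdef, AddChar.map_neg_eq_conj]
    have : (starRingEnd ℂ) (ZMod.stdAddChar m) - 1 = (starRingEnd ℂ) (ZMod.stdAddChar m - 1) := by simp
    rw [this, Complex.norm_conj]
  rw [← hlow2] at hlow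
  have hpos : 0 < 4 * ((m.val:ℝ)/N) * (1 - (m.val:ℝ)/N) := by
    have : (m.val:ℝ)/N < 1 := by rwa [div_lt_one hN]
    have h2 : 0 < 1 - (m.val:ℝ)/N := by linarith
    positivity
  have hz1 : z ≠ 1 := by
    intro h
    rw [h, sub_self, norm_zero] at hlow
    linarith
  rw [geom_sum_eq hz1, norm_div]
  have hnum : ‖z^L - 1‖ ≤ 2 := by
    calc _ ≤ ‖z^L‖ + ‖(1:ℂ)‖ := norm_sub_le _ _
      _ = 2 := by rw [norm_pow, hzn]; norm_num
  calc ‖z^L - 1‖ / ‖z - 1‖ ≤ 2 / (4 * ((m.val:ℝ)/N) * (1 - (m.val:ℝ)/N)) := by gcongr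
    _ = bb m := by
      unfold bb
      have : (N:ℝ) - m.val ≠ 0 := by linarith
      field_simp
      ring

lemma gcd_harm {N : ℕ} (hN : 0 < N) :
    ∑ k ∈ Ico 1 N, (Nat.gcd k N : ℝ) / k ≤ N.divisors.card * (1 + Real.log N) := by
  calc ∑ k ∈ Ico 1 N, (Nat.gcd k N : ℝ) / k
      ≤ ∑ k ∈ Ico 1 N, ∑ d ∈ N.divisors, if d ∣ k then (d:ℝ)/k else 0 := by
        refine sum_le_sum fun k hk => ?_
        have hd : Nat.gcd k N ∈ N.divisors := Nat.mem_divisors.2 ⟨Nat.gcd_dvd_right _ _, hN.ne'⟩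
        have := single_le_sum (f := fun d => if d ∣ k then (d:ℝ)/k else 0) (fun d _ => by split_ifs <;> positivity) hd
        simpa [Nat.gcd_dvd_left] using this
    _ = ∑ d ∈ N.divisors, ∑ k ∈ (Ico 1 N).filter (fun k => d ∣ k), (d:ℝ)/k := by
        rw [sum_comm]; simp_rw [sum_filter]
    _ ≤ ∑ d ∈ N.divisors, (1 + Real.log N) := by
        refine sum_le_sum fun d hd => ?_
        have hd0 : 0 < d := Nat.pos_of_mem_divisors hd
        refine le_trans ?_ (harmonic_le_one_add_log N)
        rw [harmonic_eq_sum_Icc]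
        push_cast
        have hinj : Set.InjOn (fun k => k / d) ((Ico 1 N).filter (fun k => d ∣ k)) := by
          intro x hx y hy hxy
          have hx' := (mem_filter.1 (mem_coe.1 hx)).2
          have hy' := (mem_filter.1 (mem_coe.1 hy)).2
          rw [← Nat.div_mul_cancel hx', ← Nat.div_mul_cancel hy']
          exact congrArg (· * d) hxy
        have h1 : ∑ k ∈ (Ico 1 N).filter (fun k => d ∣ k), (d:ℝ)/k
            = ∑ k ∈ (Ico 1 N).filter (fun k => d ∣ k), (((k / d : ℕ)):ℝ)⁻¹ := by
          refine sum_congr rfl fun k hk => ?_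
          obtain ⟨j, rfl⟩ := (mem_filter.1 hk).2
          rw [Nat.mul_div_cancel_left _ hd0]
          have : (d:ℝ) ≠ 0 := by exact_mod_cast hd0.ne'
          push_cast
          rcases eq_or_ne (j:ℝ) 0 with h | h
          · simp [h]
          · field_simp
        rw [h1, ← sum_image (f := fun j : ℕ => ((j:ℝ))⁻¹) hinj]
        refine sum_le_sum_of_subset_of_nonneg ?_ (fun _ _ _ => by positivity)
        intro j hj
        obtain ⟨k, hk, rfl⟩ := mem_image.1 hj
        obtain ⟨hk1, hk2⟩ := mem_filter.1 hk
        have hk3 := mem_Ico.1 hk1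
        refine mem_Icc.2 ⟨Nat.div_pos (Nat.le_of_dvd (by omega) hk2) hd0, (Nat.div_le_self _ _).trans hk3.2.le⟩
    _ = _ := by simp; ring

noncomputable def WW (N : ℕ) : ℝ := N * (N.divisors.card * (1 + Real.log N))

lemma bb_nonneg {N : ℕ} [NeZero N] (m : ZMod N) : 0 ≤ bb m := by
  unfold bb
  have hkN : (m.val:ℝ) < N := by exact_mod_cast ZMod.val_lt m
  have : 0 < (N:ℝ) - m.val := by linarith
  positivity

lemma sum_bb {N : ℕ} [NeZero N] :
    ∑ m ∈ univ.filter (fun m : ZMod N => m ≠ 0), (GG m : ℝ) * bb m ≤ WW N := by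
  have hN := NeZero.pos N
  have h1 : ∑ m ∈ univ.filter (fun m : ZMod N => m ≠ 0), (GG m : ℝ) * bb m
      = ∑ k ∈ Ico 1 N, (Nat.gcd k N : ℝ) * ((N:ℝ)/2 * (1/(k:ℝ) + 1/((N:ℝ) - k))) := by
    refine sum_nbij' (fun m => m.val) (fun k => (k : ZMod N)) ?_ ?_ ?_ ?_ ?_
    · intro m hm
      have : m ≠ 0 := (mem_filter.1 hm).2
      have h2 : m.val ≠ 0 := by simpa [ZMod.val_eq_zero] using this
      exact mem_Ico.2 ⟨Nat.pos_of_ne_zero h2, ZMod.val_lt m⟩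
    · intro k hk
      have hk' := mem_Ico.1 hk
      refine mem_filter.2 ⟨mem_univ _, fun h => ?_⟩
      have := Nat.le_of_dvd (by omega) ((ZMod.natCast_eq_zero_iff _ _).1 h)
      omega
    · intro m _; simp
    · intro k hk
      exact ZMod.val_natCast_of_lt (mem_Ico.1 hk).2
    · intro m _; rfl
  have h2 : ∑ k ∈ Ico 1 N, (Nat.gcd k N : ℝ) * (1/((N:ℝ) - k)) = ∑ k ∈ Ico 1 N, (Nat.gcd k N : ℝ) * (1/(k:ℝ)) := by
    refine sum_nbij' (fun k => N - k) (fun k => N - k) ?_ ?_ ?_ ?_ ?_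
    · intro k hk; have := mem_Ico.1 hk; refine mem_Ico.2 ⟨?_, ?_⟩ <;> omega
    · intro k hk; have := mem_Ico.1 hk; refine mem_Ico.2 ⟨?_, ?_⟩ <;> omega
    · intro k hk; have := mem_Ico.1 hk; omega
    · intro k hk; have := mem_Ico.1 hk; omega
    · intro k hk
      have hk' := mem_Ico.1 hk
      rw [Nat.cast_sub hk'.2.le]
      congr 2
      exact (Nat.gcd_self_sub_left hk'.2.le).symm
  have h3 := gcd_harm hN
  rw [h1]
  have h4 : ∑ k ∈ Ico 1 N, (Nat.gcd k N : ℝ) * ((N:ℝ)/2 * (1/(k:ℝ) + 1/((N:ℝ) - k)))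
      = (N:ℝ)/2 * (∑ k ∈ Ico 1 N, (Nat.gcd k N : ℝ) * (1/(k:ℝ)) + ∑ k ∈ Ico 1 N, (Nat.gcd k N : ℝ) * (1/((N:ℝ) - k))) := by
    rw [← sum_add_distrib, mul_sum]
    refine sum_congr rfl fun k _ => by ring
  rw [h4, h2]
  have h5 : ∑ k ∈ Ico 1 N, (Nat.gcd k N : ℝ) * (1/(k:ℝ)) = ∑ k ∈ Ico 1 N, (Nat.gcd k N : ℝ) / k :=
    sum_congr rfl fun k _ => by ring
  rw [h5]
  unfold WW
  have hNr : (0:ℝ) < N := by exact_mod_cast hN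
  nlinarith

def jj {N : ℕ} (v : ZMod N) : ℕ := if v.val = 0 then N else v.val

lemma reidx {N : ℕ} [NeZero N] (α : ℝ) (h0 : 0 ≤ α) (h1 : α ≤ 1) (φ : ZMod N → ℂ) :
    ∑ v : ZMod N, (if (jj v : ℝ) ≤ α * N then φ v else 0) = ∑ i ∈ range ⌊α * N⌋₊, φ ((1 + i : ℕ) : ZMod N) := by
  have hN := NeZero.pos N
  have hNr : (0:ℝ) < N := by exact_mod_cast hN
  have hj1 : ∀ v : ZMod N, 1 ≤ jj v := by
    intro v; unfold jj; split_ifs <;> omega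
  have hjc : ∀ v : ZMod N, ((jj v : ℕ) : ZMod N) = v := by
    intro v; unfold jj
    split_ifs with h
    · rw [ZMod.natCast_self]; exact ((ZMod.val_eq_zero v).1 h).symm
    · simp
  have hcj : ∀ k : ℕ, 1 ≤ k → k ≤ N → jj (k : ZMod N) = k := by
    intro k hk hk2; unfold jj
    rcases hk2.eq_or_lt with h | h
    · subst h; simp
    · rw [ZMod.val_natCast_of_lt h, if_neg (by omega)]
  have ht : ⌊α * N⌋₊ ≤ N := Nat.floor_le_of_le (by nlinarith)
  rw [← sum_filter]
  refine sum_nbij' (fun v => jj v - 1) (fun i => ((1 + i : ℕ) : ZMod N)) ?_ ?_ ?_ ?_ ?_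
  · intro v hv
    have := Nat.le_floor (mem_filter.1 hv).2
    have := hj1 v
    exact mem_range.2 (by omega)
  · intro i hi
    have := mem_range.1 hi
    refine mem_filter.2 ⟨mem_univ _, ?_⟩
    rw [hcj _ (by omega) (by omega)]
    exact (Nat.le_floor_iff (by positivity)).1 (by omega)
  · intro v _
    have := hj1 v
    rw [Nat.add_sub_cancel' this]; exact hjc v
  · intro i hi
    have := mem_range.1 hi
    rw [hcj _ (by omega) (by omega)]; omega
  · intro v _
    have := hj1 v
    rw [Nat.add_sub_cancel' this, hjc v]

noncomputable def beta (N : ℕ) : ℝ := 2 * (N:ℝ)^(3/4:ℝ) * N.divisors.card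

noncomputable def hh (α : ℝ) (N q : ℕ) : ℝ :=
  if Nat.Coprime q N then ((if (modInv N q : ℝ) ≤ α * N then 1 else 0) - α) else 0

lemma disc {N : ℕ} [NeZero N] (α : ℝ) (h0 : 0 ≤ α) (h1 : α ≤ 1) (a L : ℕ) :
    (N:ℝ)^2 * |∑ i ∈ range L, hh α N (a + i)| ≤ WW N * beta N * (1 + WW N) + L * (N + WW N * beta N) := by
  classical
  have hN := NeZero.pos N
  have hNr : (0:ℝ) < N := by exact_mod_cast hN
  have hβ : 0 ≤ beta N := by unfold beta; positivity
  set f : ZMod N → ℂ := fun x => ∑ i ∈ range L, if ((a + i : ℕ) : ZMod N) = x then 1 else 0 with hf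
  set g : ZMod N → ℂ := fun v => (if (jj v : ℝ) ≤ α * N then 1 else 0) - (α:ℂ) with hg
  have hFf : ∀ m, FT f m = ∑ i ∈ range L, ZMod.stdAddChar (-(m * ((a + i : ℕ) : ZMod N))) := by
    intro m
    unfold FT
    simp only [hf, sum_mul]
    rw [sum_comm]
    refine sum_congr rfl fun i _ => ?_
    simp
  have hf0 : ‖FT f 0‖ = L := by
    rw [hFf]; simp
  have hfm : ∀ m, m ≠ 0 → ‖FT f m‖ ≤ bb m := by
    intro m hm; rw [hFf]; exact geom_bound m hm a L
  have hFg : ∀ n, FT g n = ∑ i ∈ range ⌊α * N⌋₊, ZMod.stdAddChar (-(n * ((1 + i : ℕ) : ZMod N)))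
      - α * ∑ v : ZMod N, ZMod.stdAddChar (-(n * v)) := by
    intro n
    rw [← reidx α h0 h1 (fun v => ZMod.stdAddChar (-(n * v))), mul_sum, ← sum_sub_distrib]
    unfold FT
    refine sum_congr rfl fun v _ => ?_
    simp only [hg]
    split_ifs <;> ring
  have hg0 : ‖FT g 0‖ ≤ 1 := by
    rw [hFg]
    simp only [zero_mul, neg_zero, AddChar.map_zero_eq_one, sum_const, card_range, card_univ, ZMod.card, nsmul_eq_mul, mul_one]
    have : ((⌊α * N⌋₊ : ℂ) - α * N) = (((⌊α * N⌋₊ : ℝ) - α * N : ℝ) : ℂ) := by push_cast; ring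
    rw [this, Complex.norm_real, Real.norm_eq_abs, abs_le]
    have h2 := Nat.floor_le (show 0 ≤ α * N by positivity)
    have h3 := Nat.lt_floor_add_one (α * N)
    constructor <;> linarith
  have hgn : ∀ n, n ≠ 0 → ‖FT g n‖ ≤ bb n := by
    intro n hn
    have h2 : ∑ v : ZMod N, ZMod.stdAddChar (-(n * v)) = (0:ℂ) := by
      have := AddChar.sum_mulShift (-n) (ZMod.isPrimitive_stdAddChar N)
      rw [if_neg (by simpa using hn)] at this
      rw [← Nat.cast_zero (R := ℂ), ← this]
      refine sum_congr rfl fun v _ => ?_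
      congr 1; ring
    rw [hFg, h2, mul_zero, sub_zero]
    exact geom_bound n hn 1 _
  have hmain : (∑ u : (ZMod N)ˣ, f u * g ((u⁻¹ : (ZMod N)ˣ) : ZMod N)) = ((∑ i ∈ range L, hh α N (a + i) : ℝ) : ℂ) := by
    simp only [hf, sum_mul]
    rw [sum_comm, Complex.ofReal_sum]
    refine sum_congr rfl fun i _ => ?_
    simp only [ite_mul, one_mul, zero_mul]
    by_cases hc : Nat.Coprime (a + i) N
    · have hu : ∀ u : (ZMod N)ˣ, (((a + i : ℕ) : ZMod N) = u) ↔ u = ZMod.unitOfCoprime (a + i) hc := by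
        intro u
        rw [Units.ext_iff, ZMod.coe_unitOfCoprime]
        exact eq_comm
      simp_rw [hu]
      rw [sum_ite_eq' univ]
      have hh1 : hh α N (a + i) = (if (modInv N (a + i) : ℝ) ≤ α * N then 1 else 0) - α := if_pos hc
      rw [hh1, if_pos (mem_univ _)]
      simp only [hg]
      rw [← ZMod.inv_coe_unit, ZMod.coe_unitOfCoprime]
      have : modInv N (a + i) = jj (((a + i : ℕ) : ZMod N)⁻¹) := rfl
      rw [this]
      split_ifs <;> simp
    · have hu : ∀ u : (ZMod N)ˣ, ¬ (((a + i : ℕ) : ZMod N) = u) := by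
        intro u h
        apply hc
        rw [← ZMod.isUnit_iff_coprime, h]
        exact u.isUnit
      simp only [hu, hh, hc, if_false, sum_const_zero, Complex.ofReal_zero]
  have hb := bil f g
  rw [hmain] at hb
  have hnorm : (N:ℝ)^2 * |∑ i ∈ range L, hh α N (a + i)| = ‖∑ m : ZMod N, ∑ n : ZMod N, FT f m * FT g n * KS m n‖ := by
    rw [hb, norm_mul, Complex.norm_real, Real.norm_eq_abs]
    simp
  rw [hnorm]
  have hK1 : ∀ m n : ZMod N, ‖KS m n‖ ≤ GG m * beta N := KS_bound
  have hK2 : ∀ m n : ZMod N, ‖KS m n‖ ≤ GG n * beta N := fun m n => by rw [KS_symm]; exact KS_bound n m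
  have hK0 : ‖KS (0 : ZMod N) 0‖ ≤ N := by
    unfold KS
    simp only [zero_mul, add_zero, AddChar.map_zero_eq_one, sum_const, card_univ, ZMod.card_units_eq_totient, nsmul_eq_mul, mul_one]
    rw [Complex.norm_natCast]
    exact_mod_cast Nat.totient_le N
  have hsb := sum_bb (N := N)
  have hGG : ∀ m : ZMod N, (1:ℝ) ≤ GG m := fun m => by exact_mod_cast GG_pos m
  have hW : 0 ≤ WW N := (sum_nonneg fun m _ => mul_nonneg (by positivity) (bb_nonneg m)).trans hsb
  have hsplit : ∀ F : ZMod N → ℝ, ∑ m, F m = F 0 + ∑ m ∈ univ.filter (fun m : ZMod N => m ≠ 0), F m := by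
    intro F
    rw [← sum_filter_add_sum_filter_not univ (fun m : ZMod N => m = 0)]
    congr 1
    rw [filter_eq']
    simp
  have hgs : ∑ n, ‖FT g n‖ ≤ 1 + WW N := by
    rw [hsplit]
    refine add_le_add hg0 (le_trans (sum_le_sum fun n hn => ?_) hsb)
    have hn' : n ≠ 0 := (mem_filter.1 hn).2
    have := hgn n hn'
    have := bb_nonneg n
    nlinarith [hGG n]
  have hgs2 : ∑ n, ‖FT g n‖ * ‖KS 0 n‖ ≤ N + WW N * beta N := by
    rw [hsplit]
    refine add_le_add ?_ ?_
    · calc _ ≤ 1 * (N:ℝ) := mul_le_mul hg0 hK0 (norm_nonneg _) zero_le_one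
        _ = N := one_mul _
    · refine le_trans ?_ (mul_le_mul_of_nonneg_right hsb hβ)
      rw [sum_mul]
      refine sum_le_sum fun n hn => ?_
      · have hn' : n ≠ 0 := (mem_filter.1 hn).2
        calc _ ≤ bb n * (GG n * beta N) := mul_le_mul (hgn n hn') (hK2 0 n) (norm_nonneg _) (bb_nonneg n)
          _ = _ := by ring
  calc ‖∑ m : ZMod N, ∑ n : ZMod N, FT f m * FT g n * KS m n‖
      ≤ ∑ m : ZMod N, ∑ n : ZMod N, ‖FT f m‖ * (‖FT g n‖ * ‖KS m n‖) := by
        refine (norm_sum_le _ _).trans (sum_le_sum fun m _ => (norm_sum_le _ _).trans (sum_le_sum fun n _ => ?_))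
        rw [norm_mul, norm_mul, mul_assoc]
    _ = ∑ m : ZMod N, ‖FT f m‖ * ∑ n : ZMod N, (‖FT g n‖ * ‖KS m n‖) := by
        simp_rw [mul_sum]
    _ = L * ∑ n : ZMod N, (‖FT g n‖ * ‖KS 0 n‖) + ∑ m ∈ univ.filter (fun m : ZMod N => m ≠ 0), ‖FT f m‖ * ∑ n : ZMod N, (‖FT g n‖ * ‖KS m n‖) := by
        rw [hsplit, hf0]
    _ ≤ L * (N + WW N * beta N) + ∑ m ∈ univ.filter (fun m : ZMod N => m ≠ 0), GG m * bb m * (beta N * (1 + WW N)) := by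
        refine add_le_add (mul_le_mul_of_nonneg_left hgs2 (by positivity)) (sum_le_sum fun m hm => ?_)
        have hm' : m ≠ 0 := (mem_filter.1 hm).2
        have h3 : ∑ n : ZMod N, (‖FT g n‖ * ‖KS m n‖) ≤ (1 + WW N) * (GG m * beta N) := by
          refine le_trans (sum_le_sum fun n _ => mul_le_mul_of_nonneg_left (hK1 m n) (norm_nonneg _)) ?_
          rw [← sum_mul]
          exact mul_le_mul_of_nonneg_right hgs (by positivity)
        calc _ ≤ bb m * ((1 + WW N) * (GG m * beta N)) :=
              mul_le_mul (hfm m hm') h3 (sum_nonneg fun n _ => by positivity) (bb_nonneg m)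
          _ = _ := by ring
    _ ≤ L * (N + WW N * beta N) + WW N * (beta N * (1 + WW N)) := by
        rw [← sum_mul]
        gcongr
    _ = _ := by ring

lemma tau_mul_le (a b : ℕ) : (a * b).divisors.card ≤ a.divisors.card * b.divisors.card := by
  classical
  rcases eq_or_ne a 0 with rfl | ha
  · simp
  rcases eq_or_ne b 0 with rfl | hb
  · simp
  rw [← card_product]
  refine card_le_card_of_surjOn (fun p : ℕ × ℕ => p.1 * p.2) ?_
  intro d hd
  have hd' := Nat.dvd_of_mem_divisors (mem_coe.1 hd)
  obtain ⟨x, y, hx, hy, rfl⟩ := (Nat.dvd_mul).1 hd'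
  exact ⟨(x, y), by simp [hx, hy, ha, hb], rfl⟩

lemma tau_summable (k : ℕ) : LSeriesSummable (fun n => ((n.divisors.card : ℂ))^k) 2 := by
  induction k with
  | zero =>
    have := (LSeriesSummable_one_iff (s := 2)).2 (by norm_num)
    simpa using! this
  | succ k ih =>
    have h := ih.convolution ih
    refine Summable.of_norm_bounded (g := fun n => ‖LSeries.term _ 2 n‖) h.norm fun n => ?_
    refine LSeries.norm_term_le 2 ?_
    rw [LSeries.convolution_def]
    have e : ∑ p ∈ n.divisorsAntidiagonal, ((p.1.divisors.card : ℂ))^k * ((p.2.divisors.card : ℂ))^k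
        = ((∑ p ∈ n.divisorsAntidiagonal, p.1.divisors.card^k * p.2.divisors.card^k : ℕ) : ℂ) := by
      push_cast; rfl
    dsimp only
    rw [e, ← Nat.cast_pow, Complex.norm_natCast, Complex.norm_natCast]
    have : n.divisors.card^(k+1) ≤ ∑ p ∈ n.divisorsAntidiagonal, p.1.divisors.card^k * p.2.divisors.card^k := by
      calc n.divisors.card^(k+1) = ∑ p ∈ n.divisorsAntidiagonal, n.divisors.card^k := by
            rw [sum_const, ← Nat.map_div_right_divisors, card_map, smul_eq_mul, pow_succ, mul_comm]
        _ ≤ _ := by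
            refine sum_le_sum fun p hp => ?_
            rw [← mul_pow, ← (Nat.mem_divisorsAntidiagonal.1 hp).1]
            exact Nat.pow_le_pow_left (tau_mul_le _ _) _
    exact_mod_cast this

lemma tau_bound : ∃ C : ℝ, 1 ≤ C ∧ ∀ n : ℕ, 0 < n → (n.divisors.card : ℝ) ≤ C * (n:ℝ)^(1/48:ℝ) := by
  obtain ⟨C, hC⟩ := (tau_summable 96).le_const_mul_rpow
  refine ⟨max C 1, le_max_right _ _, fun n hn => ?_⟩
  have h := hC n hn.ne'
  have hC1 : (1:ℝ) ≤ max C 1 := le_max_right _ _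
  have hn' : (0:ℝ) < n := by exact_mod_cast hn
  refine le_of_pow_le_pow_left₀ (n := 96) (by norm_num) (by positivity) ?_
  rw [mul_pow, ← Real.rpow_natCast ((n:ℝ)^(1/48:ℝ)), ← Real.rpow_mul hn'.le]
  have e : (1/48:ℝ) * ((96:ℕ):ℝ) = 2 := by norm_num
  rw [e]
  have h2 : ‖(n.divisors.card : ℂ)^96‖ = (n.divisors.card : ℝ)^96 := by
    rw [norm_pow, Complex.norm_natCast]
  rw [h2] at h
  have h3 : (2:ℂ).re = 2 := by norm_num
  rw [h3] at h
  refine h.trans ?_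
  gcongr
  exact (le_max_left C 1).trans (le_self_pow₀ hC1 (by norm_num))

lemma disc_alg (B r N W b L : ℝ) (hB1 : 1 ≤ B) (hr1 : 1 ≤ r) (hN : N = r^48) (hL : 0 ≤ L)
    (hb0 : 0 ≤ b) (hW0 : 0 ≤ W)
    (hW : W ≤ B^2 * r^50) (hb : b ≤ 2 * B * r^37) :
    W * b * (1 + W) + L * (N + W * b) ≤ N^2 * (10 * B^5 * r^42 + 10 * B^5 * (r^6)⁻¹ * L) := by
  have hr0 : 0 < r := by linarith
  have e1 : W * b ≤ 2 * B^3 * r^87 := by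
    calc _ ≤ (B^2 * r^50) * (2 * B * r^37) := by gcongr
      _ = _ := by ring
  have e2 : W * b * (1 + W) ≤ 4 * B^5 * r^138 := by
    calc _ ≤ (2 * B^3 * r^87) * (B^2 * r^50 + B^2 * r^50) := by
          refine mul_le_mul e1 (add_le_add ?_ hW) (by positivity) (by positivity)
          exact one_le_mul_of_one_le_of_one_le (one_le_pow₀ hB1) (one_le_pow₀ hr1)
      _ = 4 * B^5 * r^137 := by ring
      _ ≤ _ := mul_le_mul_of_nonneg_left (pow_le_pow_right₀ hr1 (by norm_num)) (by positivity)
  have e3 : N + W * b ≤ 3 * B^5 * r^90 := by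
    have a1 : 1 * r^48 ≤ B^5 * r^90 :=
      mul_le_mul (one_le_pow₀ hB1) (pow_le_pow_right₀ hr1 (by norm_num)) (by positivity) (by positivity)
    have a2 : B^3 * r^87 ≤ B^5 * r^90 :=
      mul_le_mul (pow_le_pow_right₀ hB1 (by norm_num)) (pow_le_pow_right₀ hr1 (by norm_num)) (by positivity) (by positivity)
    rw [hN]; linarith
  have e4 : N^2 * (10 * B^5 * r^42 + 10 * B^5 * (r^6)⁻¹ * L) = 10 * B^5 * r^138 + L * (10 * B^5 * r^90) := by
    rw [hN]; field_simp
  rw [e4]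
  have p1 : 0 ≤ B^5 * r^138 := by positivity
  have p2 : 0 ≤ B^5 * r^90 := by positivity
  refine add_le_add (e2.trans ?_) (mul_le_mul_of_nonneg_left (e3.trans ?_) hL) <;> linarith

lemma disc2 : ∃ C : ℝ, 0 ≤ C ∧ ∀ N : ℕ, 0 < N → ∀ α : ℝ, 0 ≤ α → α ≤ 1 → ∀ a L : ℕ,
    |∑ i ∈ range L, hh α N (a + i)| ≤ C * (N:ℝ)^(7/8:ℝ) + C * (N:ℝ)^(-1/8:ℝ) * L := by
  obtain ⟨A, hA1, hA⟩ := tau_bound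
  obtain ⟨B, hB⟩ : ∃ B, B = 100 * A := ⟨_, rfl⟩
  have hB1 : 1 ≤ B := by linarith
  refine ⟨10 * B^5, by positivity, fun N hN α h0 h1 a L => ?_⟩
  have : NeZero N := ⟨hN.ne'⟩
  have hNr : (0:ℝ) < N := by exact_mod_cast hN
  have hN1 : (1:ℝ) ≤ N := by exact_mod_cast hN
  obtain ⟨r, hr⟩ : ∃ r, r = (N:ℝ)^(1/48:ℝ) := ⟨_, rfl⟩
  have hr1 : 1 ≤ r := by rw [hr]; exact Real.one_le_rpow hN1 (by norm_num)
  have hrp : ∀ k : ℕ, r^k = (N:ℝ)^((k:ℝ)/48) := by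
    intro k
    rw [hr, ← Real.rpow_natCast, ← Real.rpow_mul hNr.le]; congr 1; ring
  have ht : (N.divisors.card : ℝ) ≤ B * r := (hA N hN).trans (by rw [← hr, hB]; nlinarith)
  have hl : 1 + Real.log N ≤ B * r := by
    have := Real.log_le_rpow_div hNr.le (show (0:ℝ) < 1/48 by norm_num)
    rw [← hr] at this
    have e : r / (1/48) = 48 * r := by ring
    rw [e] at this
    nlinarith
  have hl0 : 0 ≤ 1 + Real.log N := by have := Real.log_nonneg hN1; linarith
  have hNr48 : (N:ℝ) = r^48 := by rw [hrp]; norm_num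
  have h34 : (N:ℝ)^(3/4:ℝ) = r^36 := by rw [hrp]; norm_num
  have h78 : (N:ℝ)^(7/8:ℝ) = r^42 := by rw [hrp]; norm_num
  have h18 : (N:ℝ)^(-1/8:ℝ) = (r^6)⁻¹ := by rw [hrp, ← Real.rpow_neg hNr.le]; norm_num
  clear hr
  have hr0 : 0 < r := by linarith
  have hW : WW N ≤ B^2 * r^50 := by
    unfold WW
    have m1 := mul_le_mul ht hl hl0 (by positivity)
    have m2 := mul_le_mul_of_nonneg_left m1 hNr.le
    refine m2.trans (le_of_eq ?_)
    rw [show B^2 * r^50 = r^48 * (B * r * (B * r)) by ring, hNr48]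
  have hW0 : 0 ≤ WW N := by exact mul_nonneg hNr.le (mul_nonneg (Nat.cast_nonneg _) hl0)
  have hb : beta N ≤ 2 * B * r^37 := by
    unfold beta
    rw [h34]
    have m1 := mul_le_mul_of_nonneg_left ht (show 0 ≤ 2 * r^36 by positivity)
    refine m1.trans (le_of_eq ?_)
    ring
  have hb0 : 0 ≤ beta N := by exact mul_nonneg (mul_nonneg (by norm_num) (Real.rpow_nonneg hNr.le _)) (Nat.cast_nonneg _)
  have hd := disc (N := N) α h0 h1 a L
  rw [h78, h18]
  have hN2 : (0:ℝ) < (N:ℝ)^2 := by positivity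
  refine le_of_mul_le_mul_left (hd.trans ?_) hN2
  exact disc_alg B r N _ _ L hB1 hr1 hNr48 (by positivity) hb0 hW0 hW hb

lemma abel_one (h g : ℕ → ℝ) (D : ℝ) (hg : Antitone g) (n : ℕ)
    (hS : ∀ j, ∑ i ∈ range j, h i ≤ D) :
    ∑ i ∈ range n, h i * g i ≤ D * g 0 - (D - ∑ i ∈ range n, h i) * g n := by
  induction n with
  | zero => simp
  | succ n ih =>
    rw [sum_range_succ]
    have h1 := hS (n+1)
    have h2 := hg (Nat.le_succ n)
    have h3 : ∑ i ∈ range (n+1), h i = ∑ i ∈ range n, h i + h n := sum_range_succ _ _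
    have h4 : 0 ≤ (D - ∑ i ∈ range (n+1), h i) * (g n - g (n+1)) := mul_nonneg (by linarith) (by simpa using h2)
    rw [h3] at h4 ⊢
    nlinarith

lemma abel (h g : ℕ → ℝ) (D c : ℝ) (hg : Antitone g) (hg0 : ∀ n, 0 ≤ g n) (n : ℕ)
    (hS : ∀ j, |∑ i ∈ range j, h i| ≤ D + c * j) :
    |∑ i ∈ range n, h i * g i| ≤ D * g 0 + c * ∑ i ∈ range n, g i := by
  have h1 := abel_one (fun i => h i - c) g D hg n (fun j => by
    rw [sum_sub_distrib]; have := (abs_le.1 (hS j)).2; simp; linarith)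
  have h2 := abel_one (fun i => - h i - c) g D hg n (fun j => by
    rw [sum_sub_distrib, sum_neg_distrib]; have := (abs_le.1 (hS j)).1; simp; linarith)
  have k1 : 0 ≤ (D - ∑ i ∈ range n, (h i - c)) * g n := by
    refine mul_nonneg ?_ (hg0 n)
    rw [sum_sub_distrib]; have := (abs_le.1 (hS n)).2; simp; linarith
  have k2 : 0 ≤ (D - ∑ i ∈ range n, (- h i - c)) * g n := by
    refine mul_nonneg ?_ (hg0 n)
    rw [sum_sub_distrib, sum_neg_distrib]; have := (abs_le.1 (hS n)).1; simp; linarith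
  simp only [sub_mul, neg_mul, sum_sub_distrib, sum_neg_distrib, ← mul_sum] at h1 h2 k1 k2
  rw [abs_le]
  constructor <;> linarith

noncomputable def gg (p q : ℕ) : ℝ := 1 / ((q:ℝ) * (p + q))

lemma gg_nonneg (p q : ℕ) : 0 ≤ gg p q := by unfold gg; positivity

lemma gg_le (p q : ℕ) (hq : 0 < q) : gg p q ≤ 1 / (q:ℝ)^2 := by
  unfold gg
  have : (0:ℝ) < q := by exact_mod_cast hq
  have hp : (0:ℝ) ≤ p := by positivity
  apply one_div_le_one_div_of_le (by positivity)
  nlinarith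

lemma sum_inv_sq_le (M n : ℕ) (hM : 0 < M) :
    ∑ i ∈ range n, 1 / ((M + i : ℕ):ℝ)^2 ≤ 2 / M - 2 / ((M + n : ℕ) : ℝ) := by
  induction n with
  | zero => simp
  | succ n ih =>
    rw [sum_range_succ]
    have hm : (1:ℝ) ≤ ((M + n : ℕ):ℝ) := by exact_mod_cast (by omega : 1 ≤ M + n)
    have e : ((M + (n+1) : ℕ) : ℝ) = ((M+n : ℕ):ℝ) + 1 := by push_cast; ring
    rw [e]
    generalize ((M + n : ℕ):ℝ) = m at *
    have : 1 / m^2 ≤ 2 / m - 2 / (m+1) := by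
      rw [div_sub_div _ _ (by positivity) (by positivity), div_le_div_iff₀ (by positivity) (by positivity)]
      nlinarith [mul_nonneg (show 0 ≤ m by linarith) (show 0 ≤ m - 1 by linarith)]
    linarith

lemma err_p {C : ℝ} (hC : 0 ≤ C) (hd : ∀ N : ℕ, 0 < N → ∀ α : ℝ, 0 ≤ α → α ≤ 1 → ∀ a L : ℕ,
    |∑ i ∈ range L, hh α N (a + i)| ≤ C * (N:ℝ)^(7/8:ℝ) + C * (N:ℝ)^(-1/8:ℝ) * L)
    (α : ℝ) (h0 : 0 ≤ α) (h1 : α ≤ 1) (p M n : ℕ) (hp : 0 < p) (hM : p ≤ M) :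
    |∑ i ∈ range n, hh α p (M + i) * gg p (M + i)| ≤ 3 * C * (p:ℝ)^(-9/8:ℝ) := by
  have hp' : (0:ℝ) < p := by exact_mod_cast hp
  have hM' : (p:ℝ) ≤ M := by exact_mod_cast hM
  have hg : Antitone (fun i => gg p (M + i)) := by
    intro i j hij
    unfold gg
    have : (0:ℝ) < ((M + i : ℕ):ℝ) := by exact_mod_cast (by omega)
    have h2 : ((M + i : ℕ):ℝ) ≤ ((M + j : ℕ):ℝ) := by exact_mod_cast (by omega)
    apply one_div_le_one_div_of_le (by positivity)
    gcongr
  have h := abel (fun i => hh α p (M+i)) (fun i => gg p (M+i)) _ _ hg (fun n => gg_nonneg _ _) n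
    (fun j => hd p hp α h0 h1 M j)
  refine h.trans ?_
  have g0 : gg p (M + 0) ≤ (p:ℝ)^(-2:ℝ) := by
    refine (gg_le _ _ (by omega)).trans ?_
    rw [Real.rpow_neg hp'.le, ← one_div]
    apply one_div_le_one_div_of_le (by positivity)
    simp only [add_zero]
    norm_cast
    gcongr
  have gs : ∑ i ∈ range n, gg p (M+i) ≤ 2 * (p:ℝ)^(-1:ℝ) := by
    calc _ ≤ ∑ i ∈ range n, 1 / ((M + i : ℕ):ℝ)^2 := sum_le_sum fun i _ => gg_le _ _ (by omega)
      _ ≤ _ := sum_inv_sq_le M n (by omega)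
      _ ≤ 2 / M := by have : 0 ≤ 2 / ((M + n : ℕ) : ℝ) := by positivity
                      linarith
      _ ≤ 2 / p := by gcongr
      _ = _ := by rw [Real.rpow_neg_one]; rfl
  have e1 : (p:ℝ)^(7/8:ℝ) * (p:ℝ)^(-2:ℝ) = (p:ℝ)^(-9/8:ℝ) := by
    rw [← Real.rpow_add hp']; norm_num
  have e2 : (p:ℝ)^(-1/8:ℝ) * (p:ℝ)^(-1:ℝ) = (p:ℝ)^(-9/8:ℝ) := by
    rw [← Real.rpow_add hp']; norm_num
  calc _ ≤ C * (p:ℝ)^(7/8:ℝ) * (p:ℝ)^(-2:ℝ) + C * (p:ℝ)^(-1/8:ℝ) * (2 * (p:ℝ)^(-1:ℝ)) := by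
        gcongr
    _ = C * ((p:ℝ)^(7/8:ℝ) * (p:ℝ)^(-2:ℝ)) + 2 * C * ((p:ℝ)^(-1/8:ℝ) * (p:ℝ)^(-1:ℝ)) := by ring
    _ = _ := by rw [e1, e2]; ring

lemma err_total : ∃ C : ℝ, 0 ≤ C ∧ ∀ α : ℝ, 0 ≤ α → α ≤ 1 → ∀ a N : ℕ,
    |∑ p ∈ Icc 2 N, ∑ q ∈ Ico (max p (a+1)) (N+1), hh α p q * gg p q| ≤ C := by
  obtain ⟨C, hC, hd⟩ := disc2
  have hs : Summable (fun n : ℕ => (n:ℝ)^(-9/8:ℝ)) := Real.summable_nat_rpow.2 (by norm_num)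
  refine ⟨3 * C * ∑' n : ℕ, (n:ℝ)^(-9/8:ℝ), mul_nonneg (by positivity) (tsum_nonneg fun n => by positivity), fun α h0 h1 a N => ?_⟩
  refine (abs_sum_le_sum_abs _ _).trans ?_
  calc _ ≤ ∑ p ∈ Icc 2 N, 3 * C * (p:ℝ)^(-9/8:ℝ) := by
        refine sum_le_sum fun p hp => ?_
        rw [mem_Icc] at hp
        rw [sum_Ico_eq_sum_range]
        exact err_p hC hd α h0 h1 p _ _ (by omega) (le_max_left _ _)
    _ = 3 * C * ∑ p ∈ Icc 2 N, (p:ℝ)^(-9/8:ℝ) := by rw [mul_sum]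
    _ ≤ _ := by
        gcongr
        exact hs.sum_le_tsum _ (fun n _ => by positivity)

/-- weighted coprime sum -/
noncomputable def SS (a N : ℕ) : ℝ :=
  ∑ p ∈ Icc 2 N, ∑ q ∈ Ico (max p (a+1)) (N+1), if Nat.Coprime q p then gg p q else 0

noncomputable def SA (α : ℝ) (a N : ℕ) : ℝ :=
  ∑ p ∈ Icc 2 N, ∑ q ∈ Ico (max p (a+1)) (N+1),
    if Nat.Coprime q p ∧ (modInv p q : ℝ) ≤ α * p then gg p q else 0

lemma SA_sub : ∃ C : ℝ, 0 ≤ C ∧ ∀ α : ℝ, 0 ≤ α → α ≤ 1 → ∀ a N : ℕ,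
    |SA α a N - α * SS a N| ≤ C := by
  obtain ⟨C, hC, h⟩ := err_total
  refine ⟨C, hC, fun α h0 h1 a N => ?_⟩
  have e : SA α a N - α * SS a N = ∑ p ∈ Icc 2 N, ∑ q ∈ Ico (max p (a+1)) (N+1), hh α p q * gg p q := by
    unfold SA SS
    rw [mul_sum, ← sum_sub_distrib]
    refine sum_congr rfl fun p _ => ?_
    rw [mul_sum, ← sum_sub_distrib]
    refine sum_congr rfl fun q _ => ?_
    unfold hh
    split_ifs <;> first | (exfalso; tauto) | ring
  rw [e]
  exact h α h0 h1 a N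

lemma sum_mult (d a N : ℕ) (hd : 0 < d) (f : ℕ → ℝ) :
    ∑ q ∈ Ioc a N, (if d ∣ q then f q else 0) = ∑ q ∈ Ioc (a/d) (N/d), f (d*q) := by
  rw [← sum_filter]
  refine sum_nbij' (fun q => q/d) (fun q => d*q) ?_ ?_ ?_ ?_ ?_
  · intro q hq
    rw [mem_filter, mem_Ioc] at hq
    obtain ⟨⟨h1, h2⟩, k, rfl⟩ := hq
    rw [mem_Ioc, Nat.mul_div_cancel_left _ hd, Nat.div_lt_iff_lt_mul hd, Nat.le_div_iff_mul_le hd]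
    constructor <;> linarith
  · intro q hq
    rw [mem_Ioc, Nat.div_lt_iff_lt_mul hd, Nat.le_div_iff_mul_le hd] at hq
    rw [mem_filter, mem_Ioc]
    exact ⟨⟨by linarith [hq.1], by linarith [hq.2]⟩, dvd_mul_right _ _⟩
  · intro q hq
    rw [mem_filter] at hq
    exact Nat.mul_div_cancel' hq.2
  · intro q hq
    exact Nat.mul_div_cancel_left _ hd
  · intro q hq
    rw [mem_filter] at hq
    simp only [Nat.mul_div_cancel' hq.2]

lemma cop_moebius (p q N : ℕ) (hq : 0 < q) (hN : q ≤ N) :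
    (if Nat.Coprime q p then (1:ℝ) else 0) =
      ∑ d ∈ Icc 1 N, if d ∣ q then (if d ∣ p then ((ArithmeticFunction.moebius d : ℤ) : ℝ) else 0) else 0 := by
  have h := congrArg (fun f => f (Nat.gcd q p)) ArithmeticFunction.moebius_mul_coe_zeta
  rw [ArithmeticFunction.coe_mul_zeta_apply, ArithmeticFunction.one_apply] at h
  have h' : ((∑ d ∈ (Nat.gcd q p).divisors, ArithmeticFunction.moebius d : ℤ) : ℝ) = if Nat.Coprime q p then (1:ℝ) else 0 := by
    rw [h]; unfold Nat.Coprime; split_ifs <;> simp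
  rw [← h', Int.cast_sum]
  have e : (Nat.gcd q p).divisors = (Icc 1 N).filter (fun d => d ∣ q ∧ d ∣ p) := by
    ext d
    simp only [Nat.mem_divisors, mem_filter, mem_Icc, Nat.dvd_gcd_iff]
    constructor
    · rintro ⟨⟨h1, h2⟩, _⟩
      exact ⟨⟨Nat.pos_of_dvd_of_pos h1 hq, (Nat.le_of_dvd hq h1).trans hN⟩, h1, h2⟩
    · rintro ⟨_, h1, h2⟩
      exact ⟨⟨h1, h2⟩, (Nat.gcd_pos_of_pos_left _ hq).ne'⟩
  rw [e, sum_filter]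
  refine sum_congr rfl fun d _ => ?_
  split_ifs <;> first | rfl | (exfalso; tauto)

noncomputable def ww (q : ℕ) : ℝ := ∑ p ∈ Ioc 0 q, gg p q
noncomputable def VV (a N d : ℕ) : ℝ := ∑ q ∈ Ioc (a/d) (N/d), ww q
noncomputable def TT (a N : ℕ) : ℝ := ∑ q ∈ Ioc a N, ∑ p ∈ Ioc 0 q, if Nat.Coprime q p then gg p q else 0

lemma gg_mul (d p q : ℕ) : gg (d*p) (d*q) = (1/(d:ℝ)^2) * gg p q := by
  unfold gg
  push_cast
  rw [div_mul_div_comm]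
  congr 1
  · ring
  · ring

lemma TT_eq (a N : ℕ) : TT a N = ∑ d ∈ Icc 1 N, ((ArithmeticFunction.moebius d : ℤ) : ℝ) / (d:ℝ)^2 * VV a N d := by
  unfold TT
  have : ∀ q ∈ Ioc a N, ∑ p ∈ Ioc 0 q, (if Nat.Coprime q p then gg p q else 0) =
      ∑ d ∈ Icc 1 N, if d ∣ q then ((ArithmeticFunction.moebius d : ℤ) : ℝ) * ∑ p ∈ Ioc 0 q, (if d ∣ p then gg p q else 0) else 0 := by
    intro q hq
    rw [mem_Ioc] at hq
    have : ∀ p, (if Nat.Coprime q p then gg p q else 0) = ∑ d ∈ Icc 1 N, if d ∣ q then (((ArithmeticFunction.moebius d : ℤ) : ℝ) * if d ∣ p then gg p q else 0) else 0 := by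
      intro p
      have e : (if Nat.Coprime q p then gg p q else 0) = (if Nat.Coprime q p then (1:ℝ) else 0) * gg p q := by
        split_ifs <;> simp
      rw [e, cop_moebius p q N (by omega) hq.2, sum_mul]
      refine sum_congr rfl fun d _ => ?_
      split_ifs <;> simp
    simp_rw [this]
    rw [sum_comm]
    refine sum_congr rfl fun d _ => ?_
    split_ifs
    · rw [mul_sum]
    · simp
  rw [sum_congr rfl this, sum_comm]
  refine sum_congr rfl fun d hd => ?_
  rw [mem_Icc] at hd
  have hd0 : 0 < d := by omega
  rw [sum_mult d a N hd0 (fun q => ((ArithmeticFunction.moebius d : ℤ) : ℝ) * ∑ p ∈ Ioc 0 q, (if d ∣ p then gg p q else 0))]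
  unfold VV
  rw [mul_sum]
  refine sum_congr rfl fun q _ => ?_
  rw [sum_mult d 0 (d*q) hd0 (fun p => gg p (d*q)), Nat.zero_div, Nat.mul_div_cancel_left _ hd0]
  unfold ww
  rw [mul_sum, mul_sum]
  refine sum_congr rfl fun p _ => ?_
  rw [gg_mul]
  ring

lemma SS_eq (a N : ℕ) : TT a N = SS a N + ∑ q ∈ Ioc a N, gg 1 q := by
  unfold TT SS
  have e : ∑ p ∈ Icc 2 N, ∑ q ∈ Ico (max p (a+1)) (N+1), (if Nat.Coprime q p then gg p q else 0)
      = ∑ q ∈ Ioc a N, ∑ p ∈ Icc 2 q, (if Nat.Coprime q p then gg p q else 0) := by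
    refine sum_comm' fun p q => ?_
    simp only [mem_Icc, mem_Ico, mem_Ioc]
    omega
  rw [e, ← sum_add_distrib]
  refine sum_congr rfl fun q hq => ?_
  rw [mem_Ioc] at hq
  have : Ioc 0 q = insert 1 (Icc 2 q) := by
    ext p; simp only [mem_Ioc, mem_insert, mem_Icc]; omega
  rw [this, sum_insert (by simp)]
  simp [add_comm]

lemma sum_sq_Ioc (a N : ℕ) : ∑ q ∈ Ioc a N, 1/(q:ℝ)^2 ≤ 2 := by
  have : Ioc a N = Ico (a+1) (N+1) := by ext p; simp only [mem_Ioc, mem_Ico]; omega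
  rw [this, sum_Ico_eq_sum_range]
  refine (sum_inv_sq_le (a+1) _ (by omega)).trans ?_
  have h1 : 0 ≤ 2 / ((a + 1 + (N + 1 - (a + 1)) : ℕ) : ℝ) := by positivity
  have h2 : 2 / ((a+1 : ℕ):ℝ) ≤ 2 := div_le_self (by norm_num) (by exact_mod_cast (by omega))
  linarith

lemma SS_TT (a N : ℕ) : |SS a N - TT a N| ≤ 2 := by
  rw [SS_eq, sub_add_cancel_left, abs_neg, abs_of_nonneg (sum_nonneg fun q _ => gg_nonneg _ _)]
  refine (sum_le_sum fun q hq => ?_).trans (sum_sq_Ioc a N)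
  rw [mem_Ioc] at hq
  exact gg_le _ _ (by omega)

lemma ww_approx (q : ℕ) (hq : 0 < q) : |ww q - Real.log 2 * (1 / q)| ≤ 1/(q:ℝ)^2 := by
  have hq' : (0:ℝ) < q := by exact_mod_cast hq
  have e : ww q = (1/(q:ℝ)) * ∑ i ∈ range q, 1/((q:ℝ) + i + 1) := by
    unfold ww gg
    have : Ioc 0 q = Ico 1 (q+1) := by ext p; simp only [mem_Ioc, mem_Ico]; omega
    rw [this, sum_Ico_eq_sum_range, mul_sum]
    refine sum_congr rfl fun i _ => ?_
    rw [div_mul_div_comm, one_mul]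
    push_cast
    congr 2; ring
  have up : ∀ n : ℕ, ∑ i ∈ range n, 1/((q:ℝ) + i + 1) ≤ Real.log (q + n) - Real.log q := by
    intro n
    induction n with
    | zero => simp
    | succ n ih =>
      rw [sum_range_succ]
      have h := Real.one_sub_inv_le_log_of_pos (show 0 < ((q:ℝ) + n + 1)/(q+n) by positivity)
      rw [Real.log_div (by positivity) (by positivity)] at h
      have e2 : 1 - (((q:ℝ) + n + 1)/(q+n))⁻¹ = 1/((q:ℝ) + n + 1) := by field_simp; ring
      rw [e2] at h
      push_cast
      rw [← add_assoc]
      linarith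
  have lo : ∀ n : ℕ, Real.log (q + n + 1) - Real.log (q+1) ≤ ∑ i ∈ range n, 1/((q:ℝ) + i + 1) := by
    intro n
    induction n with
    | zero => simp
    | succ n ih =>
      rw [sum_range_succ]
      have h := Real.log_le_sub_one_of_pos (show 0 < ((q:ℝ) + n + 1 + 1)/(q+n+1) by positivity)
      rw [Real.log_div (by positivity) (by positivity)] at h
      have e2 : ((q:ℝ) + n + 1 + 1)/(q+n+1) - 1 = 1/((q:ℝ) + n + 1) := by field_simp; ring
      rw [e2] at h
      push_cast
      rw [← add_assoc]
      linarith
  have u := up q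
  have l := lo q
  have e3 : Real.log ((q:ℝ)+q) = Real.log 2 + Real.log q := by
    rw [← two_mul, Real.log_mul (by norm_num) hq'.ne']
  have e4 : Real.log 2 + Real.log (q+1) - 1/q ≤ Real.log ((q:ℝ)+q+1) := by
    have h := Real.one_sub_inv_le_log_of_pos (show 0 < ((q:ℝ) + q + 1)/(2 * (q+1)) by positivity)
    rw [Real.log_div (by positivity) (by positivity), Real.log_mul (by norm_num) (by positivity)] at h
    have e2 : 1 - (((q:ℝ) + q + 1)/(2*(q+1)))⁻¹ = - (1/((q:ℝ) + q + 1)) := by field_simp; ring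
    rw [e2] at h
    have : 1/((q:ℝ)+q+1) ≤ 1/q := one_div_le_one_div_of_le hq' (by linarith)
    linarith
  have h1 : |∑ i ∈ range q, 1/((q:ℝ) + i + 1) - Real.log 2| ≤ 1/q := by
    have : 0 < 1/(q:ℝ) := by positivity
    rw [abs_le]; constructor <;> linarith
  have e5 : ww q - Real.log 2 * (1 / q) = (1/(q:ℝ)) * (∑ i ∈ range q, 1/((q:ℝ) + i + 1) - Real.log 2) := by
    rw [e]; ring
  rw [e5, abs_mul, abs_of_pos (by positivity)]
  calc _ ≤ 1/(q:ℝ) * (1/q) := by gcongr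
    _ = _ := by rw [div_mul_div_comm]; ring

noncomputable def HH (n : ℕ) : ℝ := ∑ q ∈ Ioc 0 n, 1/(q:ℝ)

lemma HH_eq (n : ℕ) : HH n = (harmonic n : ℝ) := by
  rw [harmonic_eq_sum_Icc]
  push_cast
  unfold HH
  refine sum_congr ?_ fun q _ => by rw [one_div]
  ext p; simp only [mem_Ioc, mem_Icc]; omega

lemma HH_lo (x : ℝ) (hx : 1 ≤ x) (d : ℕ) (hd : 0 < d) : Real.log x - Real.log d ≤ HH (⌊x⌋₊ / d) := by
  rw [HH_eq]
  refine le_trans ?_ (log_add_one_le_harmonic _)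
  have hd' : (0:ℝ) < d := by exact_mod_cast hd
  rw [← Real.log_div (by positivity) (by positivity), ← Nat.floor_div_natCast]
  apply Real.log_le_log (by positivity)
  push_cast
  exact (Nat.lt_floor_add_one _).le

lemma HH_mono {m n : ℕ} (h : m ≤ n) : HH m ≤ HH n := by
  unfold HH
  exact sum_le_sum_of_subset_of_nonneg (Ioc_subset_Ioc le_rfl h) fun _ _ _ => by positivity

lemma HH_up (x : ℝ) (hx : 1 ≤ x) (d : ℕ) : HH (⌊x⌋₊ / d) ≤ 1 + Real.log x := by
  refine (HH_mono (Nat.div_le_self _ _)).trans ?_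
  rw [HH_eq]
  refine (harmonic_le_one_add_log _).trans ?_
  have : 0 < ⌊x⌋₊ := Nat.floor_pos.2 hx
  have h1 : (⌊x⌋₊:ℝ) ≤ x := Nat.floor_le (by linarith)
  have := Real.log_le_log (by exact_mod_cast this) h1
  linarith

lemma VV_approx (U : ℝ) (hU : 2 ≤ U) (d : ℕ) (hd : 0 < d) :
    |VV ⌊U⌋₊ ⌊U^2⌋₊ d - Real.log 2 * Real.log U| ≤ 5 * (d:ℝ)^(1/2:ℝ) := by
  have hd1 : (1:ℝ) ≤ d := by exact_mod_cast hd
  have hUU : U ≤ U^2 := by nlinarith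
  have hle : ⌊U⌋₊ / d ≤ ⌊U^2⌋₊ / d := Nat.div_le_div_right (Nat.floor_mono hUU)
  have a1 := HH_lo U (by linarith) d hd
  have a2 := HH_up U (by linarith) d
  have b1 := HH_lo (U^2) (by linarith) d hd
  have b2 := HH_up (U^2) (by linarith) d
  rw [Real.log_pow] at b1 b2
  push_cast at b1 b2
  have s : HH (⌊U⌋₊ / d) + ∑ q ∈ Ioc (⌊U⌋₊ / d) (⌊U^2⌋₊ / d), 1/(q:ℝ) = HH (⌊U^2⌋₊ / d) := by
    unfold HH
    exact sum_Ioc_consecutive _ (Nat.zero_le _) hle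
  have v : |VV ⌊U⌋₊ ⌊U^2⌋₊ d - Real.log 2 * ∑ q ∈ Ioc (⌊U⌋₊ / d) (⌊U^2⌋₊ / d), 1/(q:ℝ)| ≤ 2 := by
    unfold VV
    rw [mul_sum, ← sum_sub_distrib]
    refine (abs_sum_le_sum_abs _ _).trans ((sum_le_sum fun q hq => ?_).trans (sum_sq_Ioc (⌊U⌋₊ / d) (⌊U^2⌋₊ / d)))
    rw [mem_Ioc] at hq
    exact ww_approx q (Nat.pos_of_ne_zero (by rintro rfl; exact absurd hq.1 (Nat.not_lt_zero _)))
  generalize ∑ q ∈ Ioc (⌊U⌋₊ / d) (⌊U^2⌋₊ / d), 1/(q:ℝ) = z1 at *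
  have l2 : Real.log 2 ≤ 1 := by have := Real.log_two_lt_d9; linarith
  have l20 : 0 ≤ Real.log 2 := Real.log_nonneg (by norm_num)
  have ld : 0 ≤ Real.log d := Real.log_nonneg hd1
  have hs : |z1 - Real.log U| ≤ 1 + Real.log d := by rw [abs_le]; constructor <;> linarith
  have hlog : Real.log d ≤ 2 * (d:ℝ)^(1/2:ℝ) := by
    have := Real.log_le_rpow_div (show (0:ℝ) ≤ d by positivity) (show (0:ℝ) < 1/2 by norm_num)
    linarith
  have hs1 : 1 ≤ (d:ℝ)^(1/2:ℝ) := Real.one_le_rpow hd1 (by norm_num)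
  have e : VV ⌊U⌋₊ ⌊U^2⌋₊ d - Real.log 2 * Real.log U = (VV ⌊U⌋₊ ⌊U^2⌋₊ d - Real.log 2 * z1) + Real.log 2 * (z1 - Real.log U) := by ring
  rw [e]
  refine (abs_add_le _ _).trans ?_
  rw [abs_mul, abs_of_nonneg l20]
  have : Real.log 2 * |z1 - Real.log U| ≤ 1 * (1 + Real.log d) := mul_le_mul l2 hs (abs_nonneg _) (by norm_num)
  linarith

lemma moebius_hasSum : HasSum (fun d : ℕ => ((ArithmeticFunction.moebius d : ℤ) : ℝ) / (d:ℝ)^2) (6 / Real.pi^2) := by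
  have hs : LSeriesSummable (fun n => ((ArithmeticFunction.moebius n : ℤ) : ℂ)) 2 :=
    ArithmeticFunction.LSeriesSummable_moebius_iff.2 (by norm_num)
  have h := LSeries_one_mul_Lseries_moebius (s := 2) (by norm_num)
  rw [LSeries_one_eq_riemannZeta (by norm_num), riemannZeta_two] at h
  have hv : LSeries (fun n => ((ArithmeticFunction.moebius n : ℤ) : ℂ)) 2 = ((6 / Real.pi^2 : ℝ) : ℂ) := by
    have hpi : (Real.pi:ℂ) ≠ 0 := by exact_mod_cast Real.pi_ne_zero
    push_cast
    field_simp at h ⊢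
    linear_combination h
  have h2 := hs.LSeriesHasSum
  rw [hv] at h2
  unfold LSeriesHasSum at h2
  rw [← Complex.hasSum_ofReal]
  convert h2 using 2 with d
  rw [LSeries.term_def]
  split_ifs with h0
  · simp [h0]
  · push_cast
    congr 1
    norm_cast

lemma TT_main : ∃ C : ℝ, 0 ≤ C ∧ ∀ U : ℝ, 2 ≤ U →
    |TT ⌊U⌋₊ ⌊U^2⌋₊ - Real.log 2 * Real.log U * (6 / Real.pi^2)| ≤ C := by
  have hs : Summable (fun n : ℕ => (n:ℝ)^(-3/2:ℝ)) := Real.summable_nat_rpow.2 (by norm_num)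
  refine ⟨5 * ∑' n : ℕ, (n:ℝ)^(-3/2:ℝ), mul_nonneg (by norm_num) (tsum_nonneg fun n => by positivity), fun U hU => ?_⟩
  set N := ⌊U^2⌋₊ with hN
  set a := ⌊U⌋₊ with ha
  have s1 : HasSum (fun d : ℕ => ((ArithmeticFunction.moebius d : ℤ) : ℝ) / (d:ℝ)^2 * VV a N d) (TT a N) := by
    rw [TT_eq]
    refine hasSum_sum_of_ne_finset_zero fun d hd => ?_
    rw [mem_Icc] at hd
    rcases Nat.eq_zero_or_pos d with rfl | h
    · simp
    · have hlt : N < d := by omega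
      have : VV a N d = 0 := by
        unfold VV
        rw [Nat.div_eq_of_lt hlt]; simp
      rw [this, mul_zero]
  have s2 := s1.sub (moebius_hasSum.mul_left (Real.log 2 * Real.log U))
  rw [← s2.tsum_eq]
  have hb : ∀ d : ℕ, ‖((ArithmeticFunction.moebius d : ℤ) : ℝ) / (d:ℝ)^2 * VV a N d - Real.log 2 * Real.log U * (((ArithmeticFunction.moebius d : ℤ) : ℝ) / (d:ℝ)^2)‖ ≤ 5 * (d:ℝ)^(-3/2:ℝ) := by
    intro d
    rcases Nat.eq_zero_or_pos d with rfl | h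
    · simp
    have hd : (0:ℝ) < d := by exact_mod_cast h
    have e : ((ArithmeticFunction.moebius d : ℤ) : ℝ) / (d:ℝ)^2 * VV a N d - Real.log 2 * Real.log U * (((ArithmeticFunction.moebius d : ℤ) : ℝ) / (d:ℝ)^2) = ((ArithmeticFunction.moebius d : ℤ) : ℝ) / (d:ℝ)^2 * (VV a N d - Real.log 2 * Real.log U) := by ring
    rw [e, norm_mul, norm_div, Real.norm_eq_abs, Real.norm_eq_abs, Real.norm_eq_abs]
    have hm : |((ArithmeticFunction.moebius d : ℤ) : ℝ)| ≤ 1 := by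
      exact_mod_cast ArithmeticFunction.abs_moebius_le_one (n := d)
    have hv := VV_approx U hU d h
    rw [abs_of_pos (show 0 < (d:ℝ)^2 by positivity)]
    calc _ ≤ 1 / (d:ℝ)^2 * (5 * (d:ℝ)^(1/2:ℝ)) := by gcongr
      _ = 5 * ((d:ℝ)^(-2:ℝ) * (d:ℝ)^(1/2:ℝ)) := by
          rw [Real.rpow_neg hd.le]; norm_cast; ring
      _ = _ := by rw [← Real.rpow_add hd]; norm_num
  have h3 := tsum_of_norm_bounded (hs.mul_left 5).hasSum hb
  rw [tsum_mul_left] at h3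
  exact h3

lemma SA_main : ∃ C : ℝ, 0 ≤ C ∧ ∀ α : ℝ, 0 ≤ α → α ≤ 1 → ∀ U : ℝ, 2 ≤ U →
    |SA α ⌊U⌋₊ ⌊U^2⌋₊ - α * (Real.log 2 * Real.log U * (6 / Real.pi^2))| ≤ C := by
  obtain ⟨C1, h1, H1⟩ := SA_sub
  obtain ⟨C2, h2, H2⟩ := TT_main
  refine ⟨C1 + 2 + C2, by positivity, fun α a0 a1 U hU => ?_⟩
  have i1 := H1 α a0 a1 ⌊U⌋₊ ⌊U^2⌋₊
  have i2 := H2 U hU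
  have i3 := SS_TT ⌊U⌋₊ ⌊U^2⌋₊
  have i4 : |SS ⌊U⌋₊ ⌊U^2⌋₊ - Real.log 2 * Real.log U * (6 / Real.pi^2)| ≤ 2 + C2 := by
    rw [abs_le] at *; constructor <;> linarith [i2.1, i2.2, i3.1, i3.2]
  have i5 : |α * (SS ⌊U⌋₊ ⌊U^2⌋₊ - Real.log 2 * Real.log U * (6 / Real.pi^2))| ≤ 1 * (2 + C2) := by
    rw [abs_mul, abs_of_nonneg a0]
    exact mul_le_mul a1 i4 (abs_nonneg _) (by norm_num)
  rw [abs_le] at *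
  constructor <;> linarith [i1.1, i1.2, i5.1, i5.2]

def LL (N p q : ℕ) : ℕ := ∑ n ∈ range (N+1), ∑ k ∈ range (N+1), if 1 ≤ k ∧ k < n ∧ n * q + k * p ≤ N then 1 else 0

lemma LL_eq (N p q : ℕ) (hq : 0 < q) : LL N p q = ∑ k ∈ Ioc 0 N, ((N - k * p) / q - k) := by
  unfold LL
  rw [sum_comm]
  have hsub : Ioc 0 N ⊆ range (N+1) := by intro k; simp only [mem_Ioc, mem_range]; omega
  rw [← sum_subset hsub]
  · refine sum_congr rfl fun k hk => ?_
    rw [mem_Ioc] at hk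
    rw [← sum_filter, sum_const, smul_eq_mul, mul_one]
    rw [← Nat.card_Ioc]
    congr 1
    ext n
    simp only [mem_filter, mem_range, mem_Ioc, Nat.le_div_iff_mul_le hq]
    constructor
    · rintro ⟨_, h1, h2, h3⟩
      exact ⟨h2, by omega⟩
    · rintro ⟨h1, h2⟩
      have h4 : n ≤ n * q := Nat.le_mul_of_pos_right n hq
      have h5 : n * q + k * p ≤ N := by
        have : 0 < n * q := Nat.mul_pos (by omega) hq
        omega
      exact ⟨by omega, by omega, h1, h5⟩
  · intro k hk hk2
    rw [mem_Ioc] at hk2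
    rw [mem_range] at hk
    refine sum_eq_zero fun n _ => ?_
    rw [if_neg]
    omega

lemma LL_term_hi (N p q k : ℕ) (hq : 0 < q) (hk : N < k * (p + q)) : (N - k * p) / q - k = 0 := by
  have : (N - k * p) / q ≤ k := by
    apply Nat.div_le_of_le_mul
    rw [mul_add] at hk
    rw [mul_comm q k]
    omega
  omega

lemma LL_term_lo (N p q k : ℕ) (hq : 0 < q) (hk : k * (p + q) ≤ N) :
    |(((N - k * p) / q - k : ℕ) : ℝ) - (((N:ℝ) - k * p)/q - k)| ≤ 1 := by
  rw [mul_add] at hk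
  have h1 : k ≤ (N - k * p) / q := by rw [Nat.le_div_iff_mul_le hq]; omega
  rw [Nat.cast_sub h1]
  have h2 : ((N - k * p : ℕ) : ℝ) = (N:ℝ) - k * p := by rw [Nat.cast_sub (by omega)]; push_cast; rfl
  rw [← h2]
  have h3 : (((N - k * p) / q : ℕ) : ℝ) ≤ ((N - k * p : ℕ) : ℝ) / q := Nat.cast_div_le
  have h4 : ((N - k * p : ℕ) : ℝ) / q < (((N - k * p) / q : ℕ) : ℝ) + 1 := by
    rw [← Nat.floor_div_eq_div (K := ℝ)]
    exact Nat.lt_floor_add_one _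
  rw [abs_le]; constructor <;> linarith

lemma sum_lin (A B : ℝ) (Y : ℕ) : ∑ k ∈ Ioc 0 Y, (A - k * B) = Y * A - B * (Y * (Y+1) / 2) := by
  induction Y with
  | zero => simp
  | succ n ih =>
    rw [← insert_Ioc_right_eq_Ioc_add_one (Nat.zero_le n), sum_insert (by simp), ih]
    push_cast; ring

lemma LL_approx (N p q : ℕ) (hp : p ≤ q) (hq : 0 < q) (hN : q ≤ N) :
    |(LL N p q : ℝ) - (N:ℝ)^2 / 2 * gg p q| ≤ 2 * (N:ℝ) / (q:ℝ) := by
  have hq' : (0:ℝ) < q := by exact_mod_cast hq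
  have hp' : (p:ℝ) ≤ q := by exact_mod_cast hp
  have hp0 : (0:ℝ) ≤ p := by positivity
  have hN' : (q:ℝ) ≤ N := by exact_mod_cast hN
  obtain ⟨Y, hY⟩ : ∃ Y, Y = N / (p + q) := ⟨_, rfl⟩
  have hs : 0 < p + q := by omega
  have hYN : Y ≤ N := by rw [hY]; exact Nat.div_le_self _ _
  have e : LL N p q = ∑ k ∈ Ioc 0 Y, ((N - k * p) / q - k) := by
    rw [LL_eq N p q hq]
    symm
    refine sum_subset (Ioc_subset_Ioc le_rfl hYN) fun k hk hk2 => ?_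
    rw [mem_Ioc] at hk hk2
    apply LL_term_hi N p q k hq
    rw [← Nat.div_lt_iff_lt_mul hs, ← hY]
    omega
  have r1 : |(LL N p q : ℝ) - ∑ k ∈ Ioc 0 Y, ((N:ℝ)/q - k * (((p:ℝ) + q)/q))| ≤ Y := by
    rw [e]; push_cast
    rw [← sum_sub_distrib]
    refine (abs_sum_le_sum_abs _ _).trans ?_
    calc _ ≤ ∑ k ∈ Ioc 0 Y, (1:ℝ) := by
          refine sum_le_sum fun k hk => ?_
          rw [mem_Ioc] at hk
          have h := LL_term_lo N p q k hq (by
            rw [← Nat.le_div_iff_mul_le hs, ← hY]; exact hk.2)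
          have e2 : ((N:ℝ) - k * p)/q - k = (N:ℝ)/q - k * (((p:ℝ) + q)/q) := by field_simp; ring
          rwa [e2] at h
      _ = Y := by simp
  rw [sum_lin] at r1
  -- bounds on Y
  have s0 : (0:ℝ) < (p:ℝ) + q := by positivity
  have y1 : (Y:ℝ) * (p + q) ≤ N := by
    have := Nat.div_mul_le_self N (p+q)
    rw [← hY] at this
    exact_mod_cast this
  have y2 : (N:ℝ) < (Y + 1) * (p + q) := by
    have := Nat.lt_div_mul_add (a := N) hs
    rw [← hY] at this
    have h : ((N:ℕ):ℝ) < ((Y * (p+q) + (p + q) : ℕ):ℝ) := by exact_mod_cast this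
    push_cast at h; linarith
  generalize hs' : (p:ℝ) + q = s at *
  have hsq : (q:ℝ) ≤ s := by linarith
  have hs2 : s ≤ 2 * q := by linarith
  have e3 : (Y:ℝ) * (N/q) - s/q * (Y * (Y+1)/2) - (N:ℝ)^2/2 * gg p q = ((N - Y*s) * ((Y+1)*s - N) - N * s) / (2 * (q * s)) := by
    unfold gg; rw [hs']; field_simp; ring
  have yb : (Y:ℝ) ≤ N / q := by
    rw [le_div_iff₀ hq']
    refine le_trans ?_ y1
    gcongr
  have r2 : |(Y:ℝ) * (N/q) - s/q * (Y * (Y+1)/2) - (N:ℝ)^2/2 * gg p q| ≤ (N:ℝ) / (q:ℝ) := by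
    rw [e3, abs_div, abs_of_pos (show 0 < 2 * (q * s) by positivity), div_le_div_iff₀ (by positivity) hq']
    have : |((N:ℝ) - Y*s) * ((Y+1)*s - N) - N * s| ≤ 2 * (N * s) := by
      have u0 : 0 ≤ (N:ℝ) - Y * s := by linarith
      have v0 : 0 ≤ (Y + 1) * s - N := by linarith
      have m0 := mul_nonneg u0 v0
      have u1 : (N:ℝ) - Y * s ≤ N := by nlinarith [show (0:ℝ) ≤ Y by positivity]
      have v1 : (Y + 1) * s - N ≤ s := by linarith
      have m1 := mul_le_mul u1 v1 v0 (by positivity)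
      have m2 : 0 ≤ (N:ℝ) * s := by positivity
      rw [abs_le]; constructor <;> linarith
    calc _ ≤ 2 * (N * s) * q := by gcongr
      _ = _ := by ring
  have e5 : 2 * (N:ℝ) / q = N / q + N / q := by ring
  rw [e5]
  rw [abs_le] at *
  constructor <;> linarith [r1.1, r1.2, r2.1, r2.2]

lemma LL_approx' (X : ℝ) (p q : ℕ) (hp : p ≤ q) (hq : 0 < q) (hX0 : 0 ≤ X) (hN : q ≤ ⌊X⌋₊) :
    |(LL ⌊X⌋₊ p q : ℝ) - X^2 / 2 * gg p q| ≤ 3 * X / q := by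
  have h := LL_approx ⌊X⌋₊ p q hp hq hN
  have h1 : (⌊X⌋₊:ℝ) ≤ X := Nat.floor_le hX0
  have h2 := Nat.lt_floor_add_one X
  have hq' : (1:ℝ) ≤ q := by exact_mod_cast hq
  have hg := gg_le p q hq
  have hg0 := gg_nonneg p q
  have hN0 : (0:ℝ) ≤ ⌊X⌋₊ := by positivity
  generalize (⌊X⌋₊:ℝ) = N at *
  have hg1 : gg p q ≤ 1/q := hg.trans (one_div_le_one_div_of_le (by positivity) (by nlinarith))
  have a1 : 0 ≤ X^2 - N^2 := by nlinarith
  have a2 : X^2 - N^2 ≤ 2 * X := by nlinarith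
  have a3 : 0 ≤ (X^2 - N^2) * gg p q := mul_nonneg a1 hg0
  have a4 : (X^2 - N^2) * gg p q ≤ 2 * X * (1/q) := mul_le_mul a2 hg1 hg0 (by positivity)
  have a5 : 2 * N / q ≤ 2 * X / q := by gcongr
  have e1 : 3 * X / q = 2 * X / q + X * (1/q) := by ring
  rw [e1]
  rw [abs_le] at *
  constructor <;> linarith [h.1, h.2]

noncomputable def RR (α : ℝ) (a N : ℕ) : ℝ :=
  ∑ p ∈ Icc 2 N, ∑ q ∈ Ico (max p (a+1)) (N+1),
    if Nat.Coprime q p ∧ (modInv p q : ℝ) ≤ α * p then (LL N p q : ℝ) else 0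

lemma RR_approx (α : ℝ) (X : ℝ) (a : ℕ) (hX0 : 0 ≤ X) :
    |RR α a ⌊X⌋₊ - X^2 / 2 * SA α a ⌊X⌋₊| ≤ 3 * X^2 := by
  unfold RR SA
  rw [mul_sum, ← sum_sub_distrib]
  refine (abs_sum_le_sum_abs _ _).trans ?_
  have h1 : (⌊X⌋₊:ℝ) ≤ X := Nat.floor_le hX0
  calc _ ≤ ∑ p ∈ Icc 2 ⌊X⌋₊, ∑ q ∈ Ico (max p (a+1)) (⌊X⌋₊+1), 3 * X / (q:ℝ) := by
        refine sum_le_sum fun p hp => ?_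
        rw [mul_sum, ← sum_sub_distrib]
        refine (abs_sum_le_sum_abs _ _).trans (sum_le_sum fun q hq => ?_)
        rw [mem_Icc] at hp
        rw [mem_Ico] at hq
        split_ifs
        · exact LL_approx' X p q (by omega) (by omega) hX0 (by omega)
        · simp; positivity
    _ = ∑ q ∈ Ioc a ⌊X⌋₊, ∑ p ∈ Icc 2 q, 3 * X / (q:ℝ) := by
        refine sum_comm' fun p q => ?_
        simp only [mem_Icc, mem_Ico, mem_Ioc]
        omega
    _ ≤ ∑ q ∈ Ioc a ⌊X⌋₊, 3 * X := by
        refine sum_le_sum fun q hq => ?_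
        rw [mem_Ioc] at hq
        have hq' : (0:ℝ) < q := by exact_mod_cast (by omega)
        rw [sum_const, nsmul_eq_mul, Nat.card_Icc]
        have : ((q + 1 - 2 : ℕ):ℝ) ≤ q := by exact_mod_cast (by omega)
        calc _ ≤ (q:ℝ) * (3 * X / q) := by gcongr
          _ = _ := by field_simp
    _ ≤ _ := by
        rw [sum_const, nsmul_eq_mul, Nat.card_Ioc]
        have : ((⌊X⌋₊ - a : ℕ):ℝ) ≤ X := le_trans (by exact_mod_cast Nat.sub_le _ _) h1
        calc _ ≤ X * (3 * X) := by gcongr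
          _ = _ := by ring

lemma case2_iff (α : ℚ) (U : ℝ) (hU : 2 ≤ U) (p q n k : ℕ) : Case2 α U p q n k ↔
    (p ∈ Icc 2 ⌊U^2⌋₊ ∧ q ∈ Ico (max p (⌊U⌋₊+1)) (⌊U^2⌋₊+1) ∧
      (Nat.Coprime q p ∧ (modInv p q : ℝ) ≤ (α:ℝ) * p)) ∧
      (1 ≤ k ∧ k < n ∧ n * q + k * p ≤ ⌊U^2⌋₊) := by
  unfold Case2
  rw [← Nat.le_floor_iff (by positivity : (0:ℝ) ≤ U^2), ← Nat.floor_lt (by linarith : (0:ℝ) ≤ U), Nat.coprime_comm]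
  generalize ⌊U^2⌋₊ = N
  generalize ⌊U⌋₊ = a
  simp only [mem_Icc, mem_Ico, max_le_iff, Nat.Coprime]
  constructor
  · rintro ⟨h1, h2, h3, h4, h5, h6, h7, h8, h9⟩
    have : q ≤ n * q := Nat.le_mul_of_pos_left q (by omega)
    exact ⟨⟨⟨h2, by omega⟩, ⟨⟨h3, h4⟩, by omega⟩, h1, h9⟩, h7, h8, h6⟩
  · rintro ⟨⟨⟨h2, h2'⟩, ⟨⟨h3, h4⟩, h4'⟩, h1, h9⟩, h7, h8, h6⟩
    have : q ≤ n * q := Nat.le_mul_of_pos_left q (by omega)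
    exact ⟨h1, h2, h3, h4, by omega, h6, h7, h8, h9⟩

lemma ncard_eq (α : ℚ) (U : ℝ) (hU : 2 ≤ U) :
    (({x : ℕ × ℕ × ℕ × ℕ | Case2 α U x.1 x.2.1 x.2.2.1 x.2.2.2}.ncard : ℝ)) = RR α ⌊U⌋₊ ⌊U^2⌋₊ := by
  classical
  obtain ⟨N, hN⟩ : ∃ N, N = ⌊U^2⌋₊ := ⟨_, rfl⟩
  obtain ⟨a, ha⟩ : ∃ a, a = ⌊U⌋₊ := ⟨_, rfl⟩
  have e : {x : ℕ × ℕ × ℕ × ℕ | Case2 α U x.1 x.2.1 x.2.2.1 x.2.2.2} =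
      ↑((range (N+1) ×ˢ range (N+1) ×ˢ range (N+1) ×ˢ range (N+1)).filter
        (fun x => Case2 α U x.1 x.2.1 x.2.2.1 x.2.2.2)) := by
    ext ⟨p, q, n, k⟩
    simp only [Set.mem_ofPred_eq, coe_filter, mem_product, mem_range]
    constructor
    · intro h
      refine ⟨?_, h⟩
      rw [case2_iff α U hU, ← hN, ← ha, mem_Icc, mem_Ico, max_le_iff] at h
      obtain ⟨⟨⟨h2, h2'⟩, ⟨⟨h3, h4⟩, h4'⟩, h1, h9⟩, h7, h8, h6⟩ := h
      have : n ≤ n * q := Nat.le_mul_of_pos_right n (by omega)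
      omega
    · exact fun h => h.2
  rw [e, Set.ncard_coe_finset, card_filter, sum_product]
  simp_rw [sum_product]
  have e2 : ∀ p q, (∑ n ∈ range (N+1), ∑ k ∈ range (N+1), if Case2 α U p q n k then 1 else 0) =
      if p ∈ Icc 2 N ∧ q ∈ Ico (max p (a+1)) (N+1) ∧ (Nat.Coprime q p ∧ (modInv p q : ℝ) ≤ (α:ℝ) * p)
      then LL N p q else 0 := by
    intro p q
    simp_rw [case2_iff α U hU, ← hN, ← ha]
    unfold LL
    split_ifs with h
    · exact sum_congr rfl fun n _ => sum_congr rfl fun k _ => if_congr (and_iff_right h) rfl rfl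
    · simp only [h, false_and, if_false, sum_const_zero]
  simp_rw [e2]
  rw [← hN, ← ha]
  unfold RR
  have hs1 : Icc 2 N ⊆ range (N+1) := by intro k; simp only [mem_Icc, mem_range]; omega
  push_cast
  symm
  rw [← sum_subset hs1]
  · refine sum_congr rfl fun p hp => ?_
    have hs2 : Ico (max p (a+1)) (N+1) ⊆ range (N+1) := by intro k; simp only [mem_Ico, mem_range]; omega
    rw [← sum_subset hs2]
    · refine sum_congr rfl fun q hq => ?_
      simp only [hp, hq, true_and]
    · intro q _ hq
      simp only [hq, false_and, and_false, if_false]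
  · intro p _ hp
    simp only [hp, false_and, if_false, sum_const_zero]

/-- **Proposition 3.1 (2).**
`R_{2,α}(U) = (α log 2/(2ζ(2))) U⁴ log U + O(U⁴)` with an absolute implied constant. -/
theorem case2_count :
    ∃ C : ℝ, 0 < C ∧ ∀ α : ℚ, 0 < α → α ≤ 1 → ∀ U : ℝ, 2 ≤ U →
      |(({x : ℕ × ℕ × ℕ × ℕ | Case2 α U x.1 x.2.1 x.2.2.1 x.2.2.2}.ncard : ℝ))
        - (α : ℝ) * Real.log 2 / (2 * (Real.pi^2/6)) * U^4 * Real.log U|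
      ≤ C * U^4 := by
  obtain ⟨C, hC, h⟩ := SA_main
  refine ⟨C + 3, by positivity, fun α h0 h1 U hU => ?_⟩
  rw [ncard_eq α U hU]
  have r1 := RR_approx (α:ℝ) (U^2) ⌊U⌋₊ (by positivity)
  have r2 := h α (by exact_mod_cast h0.le) (by exact_mod_cast h1) U hU
  have hU4 : (0:ℝ) ≤ U^4 := by positivity
  have r3 : |U^4 / 2 * (SA α ⌊U⌋₊ ⌊U^2⌋₊ - α * (Real.log 2 * Real.log U * (6 / Real.pi^2)))| ≤ U^4/2 * C := by
    rw [abs_mul, abs_of_nonneg (show 0 ≤ U^4/2 by positivity)]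
    exact mul_le_mul_of_nonneg_left r2 (by positivity)
  have e1 : (α : ℝ) * Real.log 2 / (2 * (Real.pi^2/6)) * U^4 * Real.log U = U^4/2 * (α * (Real.log 2 * Real.log U * (6 / Real.pi^2))) := by
    have := Real.pi_ne_zero
    field_simp
  have e2 : (U^2)^2 = U^4 := by ring
  rw [e2] at r1
  rw [e1]
  have p1 : 0 ≤ U^4 * C := by positivity
  rw [abs_le] at *
  constructor <;> linarith [r1.1, r1.2, r3.1, r3.2]
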